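/- arXiv:math/9802025 — 3 statements merged into one kernel-verified Lean document; each statement's English description precedes it below -/
import Mathlib

section
/- Every clique-star G with local density β(G) ≤ m has an m-representation; consequently, B(G) = β(G) for every clique-star G. -/
/-- The bandwidth of an integer labeling `f` of the vertices of `G`:
the maximum of `|f u - f v|` over edges `uv` of `G`. -/
noncomputable def bwOf {V : Type*} (G : SimpleGraph V) (f : V → ℤ) : ℕ :=
  sSup {n | ∃ u v, G.Adj u v ∧ n = (f u - f v).natAbs}

/-- The bandwidth of a graph: the minimum of `bwOf G f` over injections `f : V → ℤ`. -/
noncomputable def bandwidth {V : Type*} (G : SimpleGraph V) : ℕ :=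
  sInf {n | ∃ f : V → ℤ, Function.Injective f ∧ n = bwOf G f}

/-- The local density of a graph: the maximum of `⌈(n(H) - 1)/diam H⌉` over connected
subgraphs `H` of `G` with at least two vertices. -/
noncomputable def localDensity {V : Type*} (G : SimpleGraph V) : ℕ :=
  sSup {d | ∃ H : G.Subgraph, H.coe.Connected ∧ 2 ≤ H.verts.ncard ∧
    d = (H.verts.ncard - 1) ⌈/⌉ H.coe.diam}

/-- An `m`-representation of `G`: an injective integer labeling in which the labels of
adjacent vertices differ by at most `m`. -/
def IsMRep {V : Type*} (G : SimpleGraph V) (m : ℕ) (f : V → ℤ) : Prop :=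
  Function.Injective f ∧ ∀ u v, G.Adj u v → (f u - f v).natAbs ≤ m

/-- A clique-star: a complete graph on a vertex set `C` together with pendant leaves,
each attached to a single vertex of `C`. -/
def IsCliqueStar {V : Type*} (G : SimpleGraph V) : Prop :=
  ∃ C : Set V,
    (∀ u ∈ C, ∀ v ∈ C, u ≠ v → G.Adj u v) ∧
    (∀ u, u ∉ C → ∃! x, G.Adj u x) ∧
    (∀ u, u ∉ C → ∀ x, G.Adj u x → x ∈ C)

lemma core_fin {Λ : Type*} [Fintype Λ] (r m k : ℕ) (par : Λ → ℕ)
    (hpar : ∀ u, par u < r) (hsurj : ∀ i < r, ∃ u, par u = i)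
    (hr : r ≤ k) (hk : k ≤ m + 1)
    (hfib : ∀ i, (Finset.univ.filter (fun u => par u = i)).card + k ≤ 2 * m + 1)
    (hall : Fintype.card Λ + k ≤ 3 * m + 1) :
    ∃ P : ℕ → ℕ, (∀ i < r, ∀ j < r, P i = P j → i = j) ∧ (∀ i < r, P i ≤ m) ∧
      ∃ σ : Λ → ℕ, Function.Injective σ ∧
        ∀ u, P (par u) ≤ σ u ∧ σ u + k < 2 * m + 1 + P (par u) := by
  classical
  obtain ⟨A, hA⟩ : ∃ A : ℕ → ℕ, ∀ i, A i = (Finset.univ.filter (fun u => par u < i)).card :=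
    ⟨_, fun _ => rfl⟩
  have hAm : Monotone A := by
    intro i j hij
    rw [hA, hA]
    apply Finset.card_le_card
    intro u hu
    simp only [Finset.mem_filter, Finset.mem_univ, true_and] at hu ⊢
    omega
  have hA0 : A 0 = 0 := by simp [hA]
  have hAr : A r = Fintype.card Λ := by simp [hA, hpar]
  have hAs : ∀ i, A (i + 1) = A i + (Finset.univ.filter (fun u => par u = i)).card := by
    intro i
    rw [hA, hA, ← Finset.card_union_of_disjoint]
    · congr 1
      ext u
      simp only [Finset.mem_filter, Finset.mem_univ, true_and, Finset.mem_union]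
      omega
    · rw [Finset.disjoint_left]
      intro u
      simp only [Finset.mem_filter, Finset.mem_univ, true_and]
      omega
  have hApos : ∀ i < r, A i + 1 ≤ A (i + 1) := by
    intro i hi
    rw [hAs]
    obtain ⟨u, hu⟩ := hsurj i hi
    have : 0 < (Finset.univ.filter (fun u => par u = i)).card :=
      Finset.card_pos.2 ⟨u, by simp [hu]⟩
    omega
  have hAgap : ∀ d i, i + d ≤ r → A i + d ≤ A (i + d) := by
    intro d
    induction d with
    | zero => intro i _; simp
    | succ d ih =>
      intro i hi
      have h1 := ih i (by omega)
      have h2 := hApos (i + d) (by omega)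
      have h3 : i + (d + 1) = i + d + 1 := rfl
      rw [h3]
      omega
  have hAge : ∀ i ≤ r, i ≤ A i := by
    intro i hi
    have := hAgap i 0 (by omega)
    simpa [hA0] using this
  have hAle : ∀ i ≤ r, A i + (r - i) ≤ Fintype.card Λ := by
    intro i hi
    have := hAgap (r - i) i (by omega)
    rwa [show i + (r - i) = r by omega, hAr] at this
  have hAfib : ∀ i, A (i + 1) + k ≤ A i + (2 * m + 1) := by
    intro i
    have := hfib i
    rw [hAs]; omega
  -- the rank function
  obtain ⟨ρ, hρi, hρ1, hρ2⟩ : ∃ ρ : Λ → ℕ, Function.Injective ρ ∧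
      (∀ u, A (par u) ≤ ρ u) ∧ ∀ u, ρ u < A (par u + 1) := by
    let e := Fintype.equivFin Λ
    let κ : Λ → ℕ := fun u => par u * Fintype.card Λ + e u
    have hκ : ∀ u v, par u < par v → κ u < κ v := by
      intro u v h
      have h1 : (par u + 1) * Fintype.card Λ ≤ par v * Fintype.card Λ :=
        Nat.mul_le_mul_right _ h
      have h2 := (e u).2
      have h3 : (par u + 1) * Fintype.card Λ = par u * Fintype.card Λ + Fintype.card Λ := by ring
      show par u * Fintype.card Λ + (e u : ℕ) < par v * Fintype.card Λ + (e v : ℕ)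
      omega
    have hκi : Function.Injective κ := by
      intro u v h
      rcases lt_trichotomy (par u) (par v) with h1 | h1 | h1
      · have := hκ _ _ h1; omega
      · have h' : par u * Fintype.card Λ + (e u : ℕ) = par v * Fintype.card Λ + (e v : ℕ) := h
        rw [h1] at h'
        exact e.injective (Fin.ext (by omega))
      · have := hκ _ _ h1; omega
    have hlt : ∀ u v, κ u < κ v → (Finset.univ.filter (fun w => κ w < κ u)).card <
        (Finset.univ.filter (fun w => κ w < κ v)).card := by
      intro u v h
      apply Finset.card_lt_card
      rw [Finset.ssubset_iff_of_subset]
      · exact ⟨u, by simp [h], by simp⟩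
      · intro w hw
        simp only [Finset.mem_filter, Finset.mem_univ, true_and] at hw ⊢
        omega
    refine ⟨fun u => (Finset.univ.filter (fun w => κ w < κ u)).card, ?_, ?_, ?_⟩
    · intro u v h
      simp only at h
      rcases lt_trichotomy (κ u) (κ v) with h1 | h1 | h1
      · have := hlt _ _ h1; omega
      · exact hκi h1
      · have := hlt _ _ h1; omega
    · intro u
      rw [hA]
      apply Finset.card_le_card
      intro w hw
      simp only [Finset.mem_filter, Finset.mem_univ, true_and] at hw ⊢
      exact hκ _ _ hw
    · intro u
      rw [hA]
      apply Finset.card_lt_card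
      rw [Finset.ssubset_iff_of_subset]
      · exact ⟨u, by simp, by simp⟩
      · intro w hw
        simp only [Finset.mem_filter, Finset.mem_univ, true_and] at hw ⊢
        by_contra hc
        have := hκ u w (by omega)
        omega
  by_cases hs : Fintype.card Λ + k ≤ 2 * m + 1
  · refine ⟨fun i => i, fun i _ j _ h => h, fun i hi => by show i ≤ m; omega, ρ, hρi, ?_⟩
    intro u
    show par u ≤ ρ u ∧ ρ u + k < 2 * m + 1 + par u
    have h1 := hρ1 u
    have h2 := hρ2 u
    have h3 := hAge (par u) (hpar u).le
    have h4 := hAle (par u + 1) (hpar u)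
    omega
  · -- pivot
    obtain ⟨c, hcr, hc1, hc2⟩ : ∃ c < r, A c + k ≤ 2 * m + 1 ∧ 2 * m + 1 < A (c + 1) + k := by
      have hex : ∃ c, 2 * m + 1 < A (c + 1) + k := by
        refine ⟨r, ?_⟩
        have := hAm (Nat.le_succ r)
        rw [hAr] at this
        simp only [Nat.succ_eq_add_one] at this
        omega
      have hsp := Nat.find_spec hex
      have hmin := fun j => @Nat.find_min _ _ hex j
      generalize Nat.find hex = c at hsp hmin
      have hc1 : A c + k ≤ 2 * m + 1 := by
        rcases c with _ | c
        · rw [hA0]; omega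
        · have := hmin c (by omega); omega
      refine ⟨c, ?_, hc1, hsp⟩
      by_contra hcon
      have := hAm (show r ≤ c by omega)
      rw [hAr] at this
      omega
    have b1 := hAge c hcr.le
    have b2 := hAle (c + 1) hcr
    have b3 := hAfib c
    have b4 := hApos c hcr
    obtain ⟨p, hp1, hp2, hp3, hp4⟩ : ∃ p, c ≤ p ∧ p + (r - (c + 1)) ≤ m ∧
        A (c + 1) + k ≤ 2 * m + 1 + p ∧
        p + k + (Fintype.card Λ - A (c + 1)) + (A (c + 1) - A c) ≤ 3 * m + 1 := by
      refine ⟨max c (A (c + 1) + k - (2 * m + 1)), ?_, ?_, ?_, ?_⟩ <;> omega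
    obtain ⟨g, hg⟩ : ∃ g, Fintype.card Λ + k + g = 3 * m + 1 := ⟨_, Nat.add_sub_of_le hall⟩
    obtain ⟨t, ht⟩ : ∃ t, t = p - A c := ⟨_, rfl⟩
    refine ⟨fun i => if i < c then i else if i = c then p else m - (r - 1 - i), ?_, ?_,
      fun u => if par u < c then ρ u else if par u = c then ρ u + t else ρ u + g, ?_, ?_⟩
    · intro i hi j hj h
      simp only at h
      split_ifs at h <;> omega
    · intro i hi
      simp only
      split_ifs <;> omega
    · intro u v h
      apply hρi
      have u1 := hρ1 u
      have u2 := hρ2 u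
      have v1 := hρ1 v
      have v2 := hρ2 v
      have mono : ∀ i j, i < j → A (i + 1) ≤ A j := fun i j h => hAm h
      have m1 := mono (par u) (par v)
      have m2 := mono (par v) (par u)
      simp only at h
      split_ifs at h
      all_goals omega
    · intro u
      have u1 := hρ1 u
      have u2 := hρ2 u
      have h3 := hAge (par u) (hpar u).le
      have h4 := hAle (par u + 1) (hpar u)
      have hpu := hpar u
      simp only
      split_ifs with q1 q2
      · have : A (par u + 1) ≤ A c := hAm q1
        omega
      · rw [q2] at u1 u2
        omega
      · have : A (c + 1) ≤ A (par u) := hAm (by omega)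
        omega

lemma bdd_ld {V : Type*} [Fintype V] (G : SimpleGraph V) :
    BddAbove {d | ∃ H : G.Subgraph, H.coe.Connected ∧ 2 ≤ H.verts.ncard ∧
      d = (H.verts.ncard - 1) ⌈/⌉ H.coe.diam} := by
  classical
  exact Set.Finite.bddAbove (Set.Finite.subset
    (Set.finite_range (fun H : G.Subgraph => (H.verts.ncard - 1) ⌈/⌉ H.coe.diam))
    (by rintro d ⟨H, _, _, rfl⟩; exact ⟨H, rfl⟩))

lemma diam_pos_of {V : Type*} [Fintype V] (G : SimpleGraph V) (H : G.Subgraph)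
    (hc : H.coe.Connected) (h2 : 2 ≤ H.verts.ncard) : 0 < H.coe.diam := by
  classical
  have : Nontrivial H.verts := by
    rw [Set.nontrivial_coe_sort]
    exact (Set.one_lt_ncard_iff_nontrivial).1 h2
  have hne := SimpleGraph.connected_iff_ediam_ne_top.1 hc
  rcases Nat.eq_zero_or_pos H.coe.diam with h | h
  · rcases SimpleGraph.diam_eq_zero.1 h with h | h
    · exact absurd h hne
    · exact absurd h (not_subsingleton _)
  · exact h

lemma card_le_of_ediam {V : Type*} [Fintype V] (G : SimpleGraph V) (S : Set V) (d m : ℕ)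
    (hm : localDensity G ≤ m)
    (hd : ∀ u v : ((⊤ : G.Subgraph).induce S).verts,
      ((⊤ : G.Subgraph).induce S).coe.edist u v ≤ d) :
    S.ncard ≤ d * m + 1 := by
  classical
  by_cases h2 : 2 ≤ S.ncard
  · have hne : S.Nonempty := by
      rw [Set.nonempty_iff_ne_empty]; rintro rfl; simp at h2
    let H := (⊤ : G.Subgraph).induce S
    have hc : H.coe.Connected := by
      have : Nonempty H.verts := hne.to_subtype
      refine ⟨fun u v => ?_⟩
      apply SimpleGraph.reachable_of_edist_ne_top
      exact ne_top_of_le_ne_top (ENat.natCast_ne_top d) (hd u v)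
    have hp := diam_pos_of G H hc h2
    have hle : H.coe.diam ≤ d := by
      have : H.coe.ediam ≤ d := SimpleGraph.ediam_le_of_edist_le hd
      exact ENat.toNat_le_of_le_natCast this
    have h3 : (H.verts.ncard - 1) ⌈/⌉ H.coe.diam ≤ m :=
      (le_csSup (bdd_ld G) ⟨H, hc, h2, rfl⟩).trans hm
    rw [ceilDiv_le_iff_le_mul hp] at h3
    have h4 : H.verts.ncard = S.ncard := rfl
    have := Nat.mul_le_mul_right m hle
    rw [h4] at h3
    omega
  · omega

lemma bwOf_bdd {V : Type*} [Fintype V] (G : SimpleGraph V) (f : V → ℤ) :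
    BddAbove {n | ∃ u v, G.Adj u v ∧ n = (f u - f v).natAbs} :=
  Set.Finite.bddAbove (Set.Finite.subset
    (Set.finite_range (fun p : V × V => (f p.1 - f p.2).natAbs))
    (by rintro d ⟨u, v, _, rfl⟩; exact ⟨(u, v), rfl⟩))

lemma walk_bound {V : Type*} [Fintype V] (G : SimpleGraph V) (f : V → ℤ) (H : G.Subgraph)
    {u v : H.verts} (p : H.coe.Walk u v) :
    (f v - f u) ≤ p.length * (bwOf G f : ℤ) := by
  induction p with
  | nil => simp
  | @cons a b c h p ih =>
    have h1 : (f a - f b).natAbs ≤ bwOf G f :=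
      le_csSup (bwOf_bdd G f) ⟨a, b, H.adj_sub h, rfl⟩
    simp only [SimpleGraph.Walk.length_cons]
    push_cast
    have : f (b : V) - f a ≤ bwOf G f := by omega
    linarith

lemma ld_le_bwOf {V : Type*} [Fintype V] (G : SimpleGraph V) (f : V → ℤ)
    (hf : Function.Injective f) : localDensity G ≤ bwOf G f := by
  classical
  apply csSup_le'
  rintro d ⟨H, hc, h2, rfl⟩
  have hp := diam_pos_of G H hc h2
  rw [ceilDiv_le_iff_le_mul hp]
  have : Nonempty H.verts := hc.nonempty
  obtain ⟨u, hu⟩ := Finite.exists_min (fun x : H.verts => f x)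
  obtain ⟨v, hv⟩ := Finite.exists_max (fun x : H.verts => f x)
  obtain ⟨p, hpl⟩ := hc.exists_walk_length_eq_dist u v
  have h1 := walk_bound G f H p
  have h3 : p.length ≤ H.coe.diam := by
    rw [hpl]
    exact SimpleGraph.dist_le_diam (by
      exact SimpleGraph.connected_iff_ediam_ne_top.1 hc)
  have h4 : (H.verts.ncard : ℤ) ≤ f v - f u + 1 := by
    have h5 : H.verts.ncard ≤ (Finset.Icc (f u) (f v)).card := by
      rw [← Set.ncard_coe_finset]
      refine Set.ncard_le_ncard_of_injOn f ?_ hf.injOn (Finset.finite_toSet _)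
      intro x hx
      simp only [Finset.coe_Icc, Set.mem_Icc]
      exact ⟨hu ⟨x, hx⟩, hv ⟨x, hx⟩⟩
    rw [Int.card_Icc] at h5
    have := hu v
    omega
  have h6 : (p.length * bwOf G f : ℕ) ≤ H.coe.diam * bwOf G f := Nat.mul_le_mul_right _ h3
  have h7 : ((p.length * bwOf G f : ℕ) : ℤ) ≤ ((H.coe.diam * bwOf G f : ℕ) : ℤ) := by
    exact_mod_cast h6
  have h8 : ((p.length * bwOf G f : ℕ) : ℤ) = p.length * (bwOf G f : ℤ) := by push_cast; rfl
  omega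

lemma bw_eq {V : Type*} [Fintype V] (G : SimpleGraph V)
    (h : ∃ f : V → ℤ, IsMRep G (localDensity G) f) : bandwidth G = localDensity G := by
  obtain ⟨f, hf, hm⟩ := h
  apply le_antisymm
  · have h0 : bandwidth G ≤ bwOf G f := Nat.sInf_le ⟨f, hf, rfl⟩
    refine h0.trans ?_
    apply csSup_le'
    rintro d ⟨u, v, h, rfl⟩
    exact hm u v h
  · refine le_csInf ⟨_, f, hf, rfl⟩ ?_
    rintro n ⟨g, hg, rfl⟩
    exact ld_le_bwOf G g hg

/-- Positions on the clique extended from the vertices which carry leaves. -/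
lemma core_clique {Λ K : Type*} [Fintype Λ] [Fintype K] [DecidableEq K] (m : ℕ) (par : Λ → K)
    (hk : Fintype.card K ≤ m + 1)
    (hfib : ∀ x, (Finset.univ.filter (fun u => par u = x)).card + Fintype.card K ≤ 2 * m + 1)
    (hall : Fintype.card Λ + Fintype.card K ≤ 3 * m + 1) :
    ∃ P : K → ℕ, Function.Injective P ∧ (∀ x, P x ≤ m) ∧
      ∃ σ : Λ → ℕ, Function.Injective σ ∧
        ∀ u, P (par u) ≤ σ u ∧ σ u + Fintype.card K < 2 * m + 1 + P (par u) := by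
  classical
  let W : Finset K := Finset.univ.image par
  let e := W.equivFin
  have hW : ∀ u, par u ∈ W := fun u => Finset.mem_image_of_mem _ (Finset.mem_univ u)
  obtain ⟨P, hPi, hPm, σ, hσ, hb⟩ := core_fin W.card m (Fintype.card K)
    (fun u => (e ⟨par u, hW u⟩ : ℕ)) (fun u => (e ⟨par u, hW u⟩).2)
    (by
      intro i hi
      have hx := (e.symm ⟨i, hi⟩).2
      obtain ⟨u, -, hu⟩ := Finset.mem_image.1 hx
      refine ⟨u, ?_⟩
      have : (⟨par u, hW u⟩ : W) = e.symm ⟨i, hi⟩ := Subtype.ext hu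
      simp [this])
    (Finset.card_le_univ W) hk
    (by
      intro i
      by_cases h : ∃ u, (e ⟨par u, hW u⟩ : ℕ) = i
      · obtain ⟨u, rfl⟩ := h
        refine le_trans ?_ (hfib (par u))
        refine Nat.add_le_add_right (Finset.card_le_card ?_) _
        intro v hv
        simp only [Finset.mem_filter, Finset.mem_univ, true_and] at hv ⊢
        have := e.injective (Fin.ext hv)
        exact congrArg Subtype.val this
      · rw [Finset.filter_false_of_mem (fun u _ hu => h ⟨u, hu⟩)]
        simp only [Finset.card_empty]
        omega) hall
  let F : K → ℕ := fun x => if h : x ∈ W then P (e ⟨x, h⟩) else 0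
  have hF : ∀ x (h : x ∈ W), F x = P (e ⟨x, h⟩) := fun x h => by simp [F, h]
  have hFi : Set.InjOn F W := by
    intro x hx y hy h
    rw [hF x hx, hF y hy] at h
    have := e.injective (Fin.ext (hPi _ (e _).2 _ (e _).2 h))
    exact congrArg Subtype.val this
  have hFr : W.image F ⊆ Finset.range (m + 1) := by
    intro y hy
    obtain ⟨x, hx, rfl⟩ := Finset.mem_image.1 hy
    rw [hF x hx, Finset.mem_range]
    have := hPm _ (e ⟨x, hx⟩).2
    omega
  obtain ⟨t, ht1, ht2, ht3⟩ := Finset.exists_subsuperset_card_eq hFr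
    (n := Fintype.card K) (Finset.card_image_le.trans (Finset.card_le_univ W))
    (by simpa using hk)
  obtain ⟨g, hg⟩ := Finset.exists_equiv_extend_of_card_eq ht3.symm ht1 hFi
  refine ⟨fun x => g x, fun x y h => g.injective (Subtype.ext h), ?_, σ, hσ, ?_⟩
  · intro x
    have := Finset.mem_range.1 (ht2 (g x).2)
    show (g x : ℕ) ≤ m
    omega
  · intro u
    simp only
    rw [hg _ (hW u), hF _ (hW u)]
    exact hb u

lemma exists_rep {V : Type*} [Fintype V] (G : SimpleGraph V)
    (hG : IsCliqueStar G) (m : ℕ) (hm : localDensity G ≤ m) : ∃ f : V → ℤ, IsMRep G m f := by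
  classical
  obtain ⟨C, hC, hL, hLC⟩ := hG
  have hpar : ∀ u : {u // u ∉ C}, ∃ x : C, G.Adj u x := by
    intro u
    obtain ⟨x, hx, -⟩ := hL u u.2
    exact ⟨⟨x, hLC u u.2 x hx⟩, hx⟩
  choose par hpar using hpar
  have hun : ∀ (u : {u // u ∉ C}) (v : V), G.Adj u v → v = par u := by
    intro u v h
    exact (hL u u.2).unique h (hpar u)
  -- one-step distance
  have one : ∀ (S : Set V) (u v : ((⊤ : G.Subgraph).induce S).verts),
      ((u : V) = v ∨ G.Adj u v) → ((⊤ : G.Subgraph).induce S).coe.edist u v ≤ 1 := by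
    intro S u v h
    rcases h with h | h
    · have : u = v := Subtype.ext h
      subst this
      simp
    · have : ((⊤ : G.Subgraph).induce S).coe.Adj u v := by
        simp only [SimpleGraph.Subgraph.coe_adj, SimpleGraph.Subgraph.induce_adj,
          SimpleGraph.Subgraph.top_adj]
        exact ⟨u.2, v.2, h⟩
      exact (SimpleGraph.edist_eq_one_iff_adj.2 this).le
  have cl : ∀ x y : C, (x : V) = y ∨ G.Adj x y := by
    intro x y
    by_cases h : (x : V) = y
    · exact Or.inl h
    · exact Or.inr (hC x x.2 y y.2 h)
  have near : ∀ u : V, ∃ x : C, u = x ∨ G.Adj u x := by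
    intro u
    by_cases h : u ∈ C
    · exact ⟨⟨u, h⟩, Or.inl rfl⟩
    · exact ⟨par ⟨u, h⟩, Or.inr (hpar ⟨u, h⟩)⟩
  have hk : Fintype.card C ≤ m + 1 := by
    have := card_le_of_ediam G C 1 m hm (fun u v => one C u v (cl ⟨u, u.2⟩ ⟨v, v.2⟩))
    rw [← Nat.card_coe_set_eq, Nat.card_eq_fintype_card] at this
    omega
  have hall : Fintype.card {u // u ∉ C} + Fintype.card C ≤ 3 * m + 1 := by
    have := card_le_of_ediam G Set.univ 3 m hm (by
      intro u v
      obtain ⟨x, hx⟩ := near u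
      obtain ⟨y, hy⟩ := near v
      have h1 := one Set.univ u ⟨x, Set.mem_univ _⟩ hx
      have h2 := one Set.univ ⟨x, Set.mem_univ _⟩ ⟨y, Set.mem_univ _⟩ (cl x y)
      have h3 := one Set.univ v ⟨y, Set.mem_univ _⟩ hy
      rw [SimpleGraph.edist_comm] at h3
      refine (SimpleGraph.edist_triangle (v := ⟨x, Set.mem_univ _⟩)).trans ?_
      refine (add_le_add h1 ((SimpleGraph.edist_triangle
        (v := ⟨y, Set.mem_univ _⟩)).trans (add_le_add h2 h3))).trans ?_
      norm_num)
    rw [Set.ncard_univ, Nat.card_eq_fintype_card] at this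
    have h2 := Fintype.card_subtype_compl (fun u => u ∈ C)
    have h3 := Fintype.card_subtype_le (fun u => u ∈ C)
    have h4 : Fintype.card C = Fintype.card {u // u ∈ C} := rfl
    omega
  have hfib : ∀ x, (Finset.univ.filter (fun u => par u = x)).card + Fintype.card C
      ≤ 2 * m + 1 := by
    intro x
    let L : Finset V := (Finset.univ.filter (fun u => par u = x)).map (Function.Embedding.subtype _)
    have hLm : ∀ u ∈ L, G.Adj u x ∧ u ∉ C := by
      intro u hu
      simp only [L, Finset.mem_map, Finset.mem_filter, Finset.mem_univ, true_and] at hu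
      obtain ⟨w, hw, rfl⟩ := hu
      exact ⟨by rw [← hw]; exact hpar w, w.2⟩
    have hS : ∀ u ∈ (↑(L ∪ C.toFinset) : Set V), u = x ∨ G.Adj u x := by
      intro u hu
      simp only [Finset.coe_union, Set.mem_union, Finset.mem_coe, Set.mem_toFinset] at hu
      rcases hu with hu | hu
      · exact Or.inr (hLm u hu).1
      · exact cl ⟨u, hu⟩ x
    have hxS : (x : V) ∈ (↑(L ∪ C.toFinset) : Set V) := by simp
    have := card_le_of_ediam G (↑(L ∪ C.toFinset) : Set V) 2 m hm (by
      intro u v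
      have h1 := one _ u ⟨x, hxS⟩ (hS u u.2)
      have h2 := one _ v ⟨x, hxS⟩ (hS v v.2)
      rw [SimpleGraph.edist_comm] at h2
      refine (SimpleGraph.edist_triangle (v := ⟨x, hxS⟩)).trans ((add_le_add h1 h2).trans ?_)
      norm_num)
    rw [Set.ncard_coe_finset, Finset.card_union_of_disjoint, Finset.card_map,
      Set.toFinset_card] at this
    · exact this
    · rw [Finset.disjoint_left]
      intro u hu hu'
      exact (hLm u hu).2 (Set.mem_toFinset.1 hu')
  obtain ⟨P, hP, hPm, σ, hσ, hb⟩ := core_clique m par hk hfib hall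
  let I : Finset ℕ := Finset.univ.image (fun x : C => m + P x)
  have hIc : I.card ≤ Fintype.card C := Finset.card_image_le
  let q : ℕ → Prop := fun n => n ∉ I
  have hinf : (Set.ofPred q).Infinite := I.finite_toSet.infinite_compl
  have hlow : ∀ j, j ≤ Nat.nth q j := fun j => (Nat.nth_strictMono hinf).le_apply
  have hup : ∀ j, Nat.nth q j ≤ j + Fintype.card C := by
    intro j
    by_contra hcon
    have h1 : Nat.count q (j + Fintype.card C + 1) ≤ j := by
      rw [← not_lt]
      intro h
      have := Nat.nth_lt_of_lt_count h
      omega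
    have h0 : Nat.count q (j + Fintype.card C + 1) =
        ((Finset.range (j + Fintype.card C + 1)).filter q).card := by
      rw [Nat.count_eq_card_filter_range]
    rw [h0] at h1
    have h2 : Finset.range (j + Fintype.card C + 1) ⊆
        (Finset.range (j + Fintype.card C + 1)).filter q ∪ I := by
      intro n hn
      by_cases h : n ∈ I
      · exact Finset.mem_union_right _ h
      · exact Finset.mem_union_left _ (Finset.mem_filter.2 ⟨hn, h⟩)
    have h3 := (Finset.card_le_card h2).trans (Finset.card_union_le _ _)
    rw [Finset.card_range] at h3
    omega
  let F : V → ℕ := fun v => if h : v ∈ C then m + P ⟨v, h⟩ else Nat.nth q (σ ⟨v, h⟩)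
  have hF1 : ∀ v (h : v ∈ C), F v = m + P ⟨v, h⟩ := fun v h => by simp [F, h]
  have hF2 : ∀ v (h : v ∉ C), F v = Nat.nth q (σ ⟨v, h⟩) := fun v h => by simp [F, h]
  have hne : ∀ u v, u ∈ C → v ∉ C → F u ≠ F v := by
    intro u v hu hv h
    have h1 : F v ∉ I := by
      rw [hF2 v hv]; exact Nat.nth_mem_of_infinite hinf _
    apply h1
    rw [← h, hF1 u hu]
    exact Finset.mem_image_of_mem (fun x : C => m + P x) (Finset.mem_univ _)
  have hFi : Function.Injective F := by
    intro u v h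
    by_cases hu : u ∈ C <;> by_cases hv : v ∈ C
    · rw [hF1 u hu, hF1 v hv] at h
      exact congrArg Subtype.val (hP (Nat.add_left_cancel h))
    · exact absurd h (hne u v hu hv)
    · exact absurd h.symm (hne v u hv hu)
    · rw [hF2 u hu, hF2 v hv] at h
      exact congrArg Subtype.val (hσ (Nat.nth_injective hinf h))
  have hleaf : ∀ u v, u ∉ C → G.Adj u v → F u ≤ F v + m ∧ F v ≤ F u + m := by
    intro u v hu h
    have hv := hun ⟨u, hu⟩ v h
    have h1 := hlow (σ ⟨u, hu⟩)
    have h2 := hup (σ ⟨u, hu⟩)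
    have h3 := hb ⟨u, hu⟩
    have h4 : F v = m + P (par ⟨u, hu⟩) := by
      rw [hv, hF1 _ (par ⟨u, hu⟩).2]
    rw [h4, hF2 u hu]
    omega
  refine ⟨fun v => (F v : ℤ), fun u v h => hFi (Int.ofNat_inj.1 h), ?_⟩
  intro u v h
  have key : F u ≤ F v + m ∧ F v ≤ F u + m := by
    by_cases hu : u ∈ C
    · by_cases hv : v ∈ C
      · rw [hF1 u hu, hF1 v hv]
        have h1 := hPm ⟨u, hu⟩
        have h2 := hPm ⟨v, hv⟩
        omega
      · exact (hleaf v u hv h.symm).symm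
    · exact hleaf u v hu h
  simp only
  omega

/-- Every clique-star with local density at most `m` has an `m`-representation;
consequently its bandwidth equals its local density. -/
theorem cliqueStar_bandwidth_eq_localDensity {V : Type*} [Fintype V] (G : SimpleGraph V)
    (hG : IsCliqueStar G) :
    (∀ m : ℕ, localDensity G ≤ m → ∃ f : V → ℤ, IsMRep G m f) ∧
    bandwidth G = localDensity G := by
  exact ⟨fun m hm => exists_rep G hG m hm, bw_eq G (exists_rep G hG _ le_rfl)⟩
end

section
/- For every block caterpillar G, the bandwidth equals the local density: B(G) = β(G). -/
/-- A block caterpillar: cliques `Q 0, …, Q (k-1)` where consecutive cliques share exactly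
one (cut)vertex and non-consecutive cliques are disjoint (so the cutvertices induce a path),
together with pendant leaves attached to clique vertices; all edges of the graph are
clique edges or pendant edges. -/
def IsBlockCaterpillar {V : Type*} (G : SimpleGraph V) : Prop :=
  ∃ (k : ℕ) (Q : Fin k → Set V), 1 ≤ k ∧
    (∀ i, ∀ u ∈ Q i, ∀ v ∈ Q i, u ≠ v → G.Adj u v) ∧
    (∀ i j : Fin k, (j : ℕ) = (i : ℕ) + 1 → ∃ v, Q i ∩ Q j = {v}) ∧
    (∀ i j : Fin k, (i : ℕ) + 1 < (j : ℕ) → Q i ∩ Q j = ∅) ∧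
    (∀ v, v ∉ (⋃ i, Q i) → (∃! x, G.Adj v x) ∧ ∀ x, G.Adj v x → x ∈ ⋃ i, Q i) ∧
    (∀ u v, G.Adj u v → u ∈ (⋃ i, Q i) → v ∈ (⋃ i, Q i) → ∃ i, u ∈ Q i ∧ v ∈ Q i)


namespace BC

open Finset

/-- Hall's theorem for intervals of integers. -/
theorem interval_hall {V : Type*} (S : Finset V) (lo hi : V → ℤ)
    (hne : ∀ v ∈ S, lo v ≤ hi v)
    (hc : ∀ s t : ℤ, s ≤ t →
      ((S.filter (fun v => s ≤ lo v ∧ hi v ≤ t)).card : ℤ) ≤ t + 1 - s) :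
    ∃ f : V → ℤ, Set.InjOn f S ∧ ∀ v ∈ S, lo v ≤ f v ∧ f v ≤ hi v := by
  classical
  have key : ∀ n : ℕ, ∀ A : Finset V, A ⊆ S → A.card = n →
      A.card ≤ (A.biUnion (fun v => Finset.Icc (lo v) (hi v))).card := by
    intro n
    induction n using Nat.strong_induction_on with
    | _ n ih =>
      intro A hA hn
      rcases A.eq_empty_or_nonempty with rfl | hAne
      · simp
      obtain ⟨v0, hv0, hmin⟩ := A.exists_min_image lo hAne
      set U := A.biUnion (fun v => Finset.Icc (lo v) (hi v)) with hU
      have hex : ∃ d : ℕ, lo v0 + d + 1 ∉ U := by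
        obtain ⟨M, hM⟩ := U.bddAbove
        refine ⟨(M - lo v0).toNat, fun h => ?_⟩
        have := hM h
        omega
      classical
      set d := Nat.find hex with hd
      have hd1 : lo v0 + d + 1 ∉ U := Nat.find_spec hex
      have hd2 : ∀ e : ℕ, e < d → lo v0 + e + 1 ∈ U := fun e he => by
        by_contra h
        exact Nat.find_min hex he h
      have h0 : lo v0 ∈ U := by
        rw [hU, mem_biUnion]
        exact ⟨v0, hv0, by simp [hne v0 (hA hv0)]⟩
      have hsub : Finset.Icc (lo v0) (lo v0 + d) ⊆ U := by
        intro x hx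
        rw [mem_Icc] at hx
        rcases eq_or_lt_of_le hx.1 with h | h
        · rw [← h]; exact h0
        · have := hd2 (x - lo v0 - 1).toNat (by omega)
          have e : lo v0 + ((x - lo v0 - 1).toNat : ℤ) + 1 = x := by omega
          rwa [e] at this
      set A1 := A.filter (fun v => lo v ≤ lo v0 + d) with hA1
      set A2 := A.filter (fun v => ¬ lo v ≤ lo v0 + d) with hA2
      have hcard : A1.card + A2.card = A.card := by
        rw [hA1, hA2]; exact Finset.card_filter_add_card_filter_not _
      have h1 : (A1.card : ℤ) ≤ d + 1 := by
        have := hc (lo v0) (lo v0 + d) (by omega)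
        have h2 : A1 ⊆ S.filter (fun v => lo v0 ≤ lo v ∧ hi v ≤ lo v0 + d) := by
          intro v hv
          rw [hA1, mem_filter] at hv
          rw [mem_filter]
          refine ⟨hA hv.1, hmin v hv.1, ?_⟩
          by_contra hcon
          apply hd1
          rw [hU, mem_biUnion]
          exact ⟨v, hv.1, by rw [mem_Icc]; omega⟩
        have h3 := Finset.card_le_card h2
        have h4 : (A1.card : ℤ) ≤ _ := Int.ofNat_le.mpr h3
        linarith
      have hv01 : v0 ∈ A1 := by
        rw [hA1, mem_filter]; exact ⟨hv0, by omega⟩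
      have hpos : 0 < A1.card := Finset.card_pos.mpr ⟨v0, hv01⟩
      have h2 := ih A2.card (by omega) A2 ((Finset.filter_subset _ _).trans hA) rfl
      have hdisj : Disjoint (Finset.Icc (lo v0) (lo v0 + d))
          (A2.biUnion (fun v => Finset.Icc (lo v) (hi v))) := by
        rw [Finset.disjoint_left]
        intro x hx hx2
        rw [mem_biUnion] at hx2
        obtain ⟨v, hv, hx2⟩ := hx2
        rw [hA2, mem_filter] at hv
        rw [mem_Icc] at hx hx2
        omega
      have h5 : ((Finset.Icc (lo v0) (lo v0 + d)) ∪
          (A2.biUnion (fun v => Finset.Icc (lo v) (hi v)))).card ≤ U.card := by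
        apply Finset.card_le_card
        apply Finset.union_subset hsub
        exact Finset.biUnion_subset_biUnion_of_subset_left _ (Finset.filter_subset _ _)
      rw [Finset.card_union_of_disjoint hdisj, Int.card_Icc] at h5
      omega
  have hall := (Finset.all_card_le_biUnion_card_iff_exists_injective
    (fun v : S => Finset.Icc (lo v) (hi v))).1 (by
      intro A
      have := key _ (A.map (Function.Embedding.subtype _)) (by
        intro x hx
        simp only [mem_map, Function.Embedding.subtype_apply] at hx
        obtain ⟨a, _, rfl⟩ := hx
        exact a.2) rfl
      rw [Finset.card_map] at this
      refine this.trans (le_of_eq ?_)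
      congr 1
      ext x
      simp)
  obtain ⟨g, hg, hgm⟩ := hall
  refine ⟨fun v => if h : v ∈ S then g ⟨v, h⟩ else 0, ?_, ?_⟩
  · intro u hu v hv huv
    have hu' : u ∈ S := hu
    have hv' : v ∈ S := hv
    simp only [hu', hv', dif_pos] at huv
    have := hg huv
    simpa using this
  · intro v hv
    simp only [hv, dif_pos]
    have := hgm ⟨v, hv⟩
    rwa [mem_Icc] at this

/-- The four kinds of vertices: cut vertices, interior clique vertices, leaves at cut vertices,
leaves at interior vertices. -/
inductive Kd
  | cut
  | int
  | cl
  | il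

/-- Left end of the window (in multiples of `b`). -/
def loF : Kd → ℤ → ℤ
  | Kd.cut, m => m
  | Kd.int, m => m
  | Kd.cl, m => m - 1
  | Kd.il, m => m - 1

/-- Right end of the window (in multiples of `b`). -/
def hiF : Kd → ℤ → ℤ
  | Kd.cut, m => m
  | Kd.int, m => m + 1
  | Kd.cl, m => m + 1
  | Kd.il, m => m + 2

/-- Classification data of vertices. -/
structure Dat (V : Type*) where
  K : V → Kd
  ix : V → ℤ
  ow : V → V

namespace Dat
variable {V : Type*}

def lo (D : Dat V) (v : V) : ℤ := loF (D.K v) (D.ix v)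
def hi (D : Dat V) (v : V) : ℤ := hiF (D.K v) (D.ix v)

theorem lo_le_hi (D : Dat V) (v : V) : D.lo v ≤ D.hi v := by
  unfold lo hi
  cases D.K v <;> simp [loF, hiF] <;> omega

end Dat

/-- Combinatorial hypotheses on the data. -/
structure Comb {V : Type*} [Fintype V] (D : Dat V) (b : ℤ) : Prop where
  bpos : 1 ≤ b
  cut_uniq : ∀ x y, D.K x = Kd.cut → D.K y = Kd.cut → D.ix x = D.ix y → x = y
  int_cut : ∀ x, D.K x = Kd.int → (∃ c, D.K c = Kd.cut ∧ D.ix c = D.ix x) ∧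
    (∃ c, D.K c = Kd.cut ∧ D.ix c = D.ix x + 1)
  il_cut : ∀ x, D.K x = Kd.il → (∃ c, D.K c = Kd.cut ∧ D.ix c = D.ix x - 1) ∧
    (∃ c, D.K c = Kd.cut ∧ D.ix c = D.ix x + 2)
  il_ow : ∀ x, D.K x = Kd.il → D.K (D.ow x) = Kd.int ∧ D.ix (D.ow x) = D.ix x
  dens : ∀ i j : ℤ, i < j → ∀ A : Finset V, (∀ v ∈ A, i ≤ D.lo v ∧ D.hi v ≤ j) →
    (A.card : ℤ) ≤ (j - i) * b + 1
  star : ∀ z, D.K z = Kd.int → ∀ A B : Finset V, (∀ v ∈ A, D.K v = Kd.int ∧ D.ix v = D.ix z) →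
    (∀ v ∈ B, D.K v = Kd.il ∧ D.ow v = z) → (A.card : ℤ) + B.card + 2 ≤ 2 * b + 1

/-- Feasible labelings: every vertex gets a label in its window. -/
def Feas {V : Type*} (D : Dat V) (b : ℤ) (f : V → ℤ) : Prop :=
  Function.Injective f ∧ ∀ v, D.lo v * b ≤ f v ∧ f v ≤ D.hi v * b

theorem exists_feas {V : Type*} [Fintype V] {D : Dat V} {b : ℤ} (h : Comb D b) :
    ∃ f, Feas D b f := by
  classical
  have hb := h.bpos
  obtain ⟨f, hf, hw⟩ := interval_hall (Finset.univ : Finset V) (fun v => D.lo v * b)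
    (fun v => D.hi v * b)
    (fun v _ => mul_le_mul_of_nonneg_right (D.lo_le_hi v) (by omega)) (by
      intro s t hst
      set A := (Finset.univ : Finset V).filter (fun v => s ≤ D.lo v * b ∧ D.hi v * b ≤ t) with hA
      have hmem : ∀ v ∈ A, s ≤ D.lo v * b ∧ D.hi v * b ≤ t := fun v hv => by
        rw [hA, mem_filter] at hv; exact hv.2
      rcases A.eq_empty_or_nonempty with h0 | ⟨v0, hv0⟩
      · rw [h0]; simp; omega
      obtain ⟨u, hu, hmin⟩ := A.exists_min_image D.lo ⟨v0, hv0⟩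
      obtain ⟨w, hw, hmax⟩ := A.exists_max_image D.hi ⟨v0, hv0⟩
      have h1 := (hmem u hu).1
      have h2 := (hmem w hw).2
      have h3 : D.lo u ≤ D.hi w := (hmin w hw).trans (D.lo_le_hi w)
      rcases eq_or_lt_of_le h3 with h4 | h4
      · have : A.card ≤ 1 := by
          rw [Finset.card_le_one]
          have hh : ∀ x ∈ A, D.K x = Kd.cut ∧ D.ix x = D.lo u := by
            intro x hx
            have e1 := hmin x hx
            have e2 := hmax x hx
            have e3 : D.lo x = D.hi x := le_antisymm (D.lo_le_hi x) (by omega)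
            have e4 : D.lo x = D.lo u := by omega
            unfold Dat.lo Dat.hi at e3
            rw [← e4]
            unfold Dat.lo
            revert e3
            cases D.K x <;> simp [loF, hiF]
            all_goals omega
          intro x hx y hy
          exact h.cut_uniq x y (hh x hx).1 (hh y hy).1 ((hh x hx).2.trans (hh y hy).2.symm)
        have : (A.card : ℤ) ≤ 1 := by exact_mod_cast this
        omega
      · have := h.dens _ _ h4 A (fun v hv => ⟨hmin v hv, hmax v hv⟩)
        have e : (D.hi w - D.lo u) * b = D.hi w * b - D.lo u * b := by ring
        linarith)
  exact ⟨f, fun x y hxy => hf (by simp) (by simp) hxy, fun v => hw v (by simp)⟩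

/-- Distance of `p` from the gap `[m b, (m+1) b]`. -/
def gd (b m p : ℤ) : ℤ := max 0 (m * b - p) + max 0 (p - (m + 1) * b)

open Classical in
noncomputable def pot1 {V : Type*} [Fintype V] (D : Dat V) (b : ℤ) (f : V → ℤ) : ℤ :=
  ∑ v, if D.K v = Kd.il then gd b (D.ix v) (f v) else 0

open Classical in
noncomputable def pot2 {V : Type*} [Fintype V] (D : Dat V) (r : V → ℤ) (f : V → ℤ) : ℤ :=
  ∑ v, if D.K v = Kd.il then - (r (D.ow v) * f v) else 0

/-- Optimal labelings. -/
structure Opt {V : Type*} [Fintype V] (D : Dat V) (b : ℤ) (r : V → ℤ) (f : V → ℤ) : Prop where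
  feas : Feas D b f
  min1 : ∀ g, Feas D b g → pot1 D b f ≤ pot1 D b g
  min2 : ∀ g, Feas D b g → pot1 D b g = pot1 D b f → pot2 D r f ≤ pot2 D r g

theorem exists_opt {V : Type*} [Fintype V] {D : Dat V} {b : ℤ} (h : Comb D b) (r : V → ℤ) :
    ∃ f, Opt D b r f := by
  have hfin : {f | Feas D b f}.Finite := by
    classical
    apply Set.Finite.subset (Set.finite_Icc (fun v => D.lo v * b) (fun v => D.hi v * b))
    intro f hf
    exact ⟨fun v => (hf.2 v).1, fun v => (hf.2 v).2⟩
  obtain ⟨f, hf, hmin⟩ := Set.exists_min_image {f | Feas D b f}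
    (fun f => toLex (pot1 D b f, pot2 D r f)) hfin (exists_feas h)
  refine ⟨f, hf, fun g hg => ?_, fun g hg he => ?_⟩
  · have := hmin g hg
    rw [Prod.Lex.toLex_le_toLex] at this
    rcases this with h | h
    · exact le_of_lt h
    · exact le_of_eq h.1
  · have := hmin g hg
    rw [Prod.Lex.toLex_le_toLex] at this
    rcases this with h | h
    · simp only at h; omega
    · exact h.2

theorem Feas.swap {V : Type*} [DecidableEq V] {D : Dat V} {b : ℤ} {f : V → ℤ} (hf : Feas D b f)
    {a u : V} (h1 : D.lo a * b ≤ f u) (h2 : f u ≤ D.hi a * b)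
    (h3 : D.lo u * b ≤ f a) (h4 : f a ≤ D.hi u * b) :
    Feas D b (fun v => f (Equiv.swap a u v)) := by
  refine ⟨hf.1.comp (Equiv.swap a u).injective, fun v => ?_⟩
  rcases eq_or_ne v a with rfl | hva
  · simp [h1, h2]
  rcases eq_or_ne v u with rfl | hvu
  · simp [h3, h4]
  · simp only [Equiv.swap_apply_of_ne_of_ne hva hvu]; exact hf.2 v

theorem Feas.move {V : Type*} [DecidableEq V] {D : Dat V} {b : ℤ} {f : V → ℤ} (hf : Feas D b f)
    {a : V} {p : ℤ} (hp : ∀ u, f u ≠ p) (h1 : D.lo a * b ≤ p) (h2 : p ≤ D.hi a * b) :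
    Feas D b (Function.update f a p) := by
  refine ⟨?_, fun v => ?_⟩
  · intro x y hxy
    by_cases hx : x = a <;> by_cases hy : y = a
    · rw [hx, hy]
    · subst hx; simp [Function.update_of_ne hy] at hxy; exact absurd hxy.symm (hp y)
    · subst hy; simp [Function.update_of_ne hx] at hxy; exact absurd hxy (hp x)
    · simp [Function.update_of_ne hx, Function.update_of_ne hy] at hxy; exact hf.1 hxy
  · rcases eq_or_ne v a with rfl | hva
    · simp [h1, h2]
    · simp only [Function.update_of_ne hva]; exact hf.2 v

section
variable {V : Type*} [Fintype V] {D : Dat V} {b : ℤ} {r f : V → ℤ}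

theorem Opt.no_improve (ho : Opt D b r f) {g : V → ℤ} (hg : Feas D b g) {a : V}
    (ha : D.K a = Kd.il) (hlt : gd b (D.ix a) (g a) < gd b (D.ix a) (f a))
    (hle : ∀ v, D.K v = Kd.il → gd b (D.ix v) (g v) ≤ gd b (D.ix v) (f v)) : False := by
  have h1 := ho.min1 g hg
  have h2 : pot1 D b g < pot1 D b f := by
    unfold pot1
    apply Finset.sum_lt_sum
    · intro v _
      split_ifs with h
      · exact hle v h
      · exact le_rfl
    · exact ⟨a, by simp, by simp [ha, hlt]⟩
  omega

/-- Positions between a left-crossing leaf and the right end of its gap. -/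
theorem Opt.left (h : Comb D b) (ho : Opt D b r f) {a : V} (ha : D.K a = Kd.il)
    (hc : f a < D.ix a * b) {p : ℤ} (hp1 : f a < p) (hp2 : p ≤ (D.ix a + 1) * b) :
    ∃ u, f u = p ∧ ((D.K u = Kd.il ∧ D.ix u = D.ix a) ∨ D.ix a ≤ D.lo u) := by
  classical
  have hb := h.bpos
  have hloa : D.lo a = D.ix a - 1 := by simp [Dat.lo, ha, loF]
  have hhia : D.hi a = D.ix a + 2 := by simp [Dat.hi, ha, hiF]
  have hwa := ho.feas.2 a
  rw [hloa, hhia] at hwa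
  have e1 : (D.ix a - 1) * b = D.ix a * b - b := by ring
  have e2 : (D.ix a + 2) * b = D.ix a * b + 2 * b := by ring
  have e3 : (D.ix a + 1) * b = D.ix a * b + b := by ring
  have hgda : gd b (D.ix a) p < gd b (D.ix a) (f a) := by
    unfold gd; omega
  by_contra hcon
  push Not at hcon
  by_cases hex : ∃ u, f u = p
  · obtain ⟨u, hu⟩ := hex
    obtain ⟨hu1, hu2⟩ := hcon u hu
    have hwu := ho.feas.2 u
    have h3 : D.lo u * b ≤ (D.ix a - 1) * b := mul_le_mul_of_nonneg_right (by omega) (by omega)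
    have hau : u ≠ a := by rintro rfl; omega
    refine ho.no_improve (a := a) (ho.feas.swap (a := a) (u := u) (by rw [hloa]; omega)
      (by rw [hhia]; omega) (by omega) (by omega)) ha (by simpa [hu] using hgda) ?_
    intro v hv
    rcases eq_or_ne v a with rfl | hva
    · simpa [hu] using hgda.le
    rcases eq_or_ne v u with rfl | hvu
    · simp only [Equiv.swap_apply_right]
      have hlov : D.lo v = D.ix v - 1 := by simp [Dat.lo, hv, loF]
      have h5 := hu1 hv
      have h4 : D.ix v * b ≤ (D.ix a - 1) * b := mul_le_mul_of_nonneg_right (by omega) (by omega)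
      unfold gd; omega
    · simp [Equiv.swap_apply_of_ne_of_ne hva hvu]
  · push Not at hex
    refine ho.no_improve (a := a) (ho.feas.move (a := a) hex (by rw [hloa]; omega)
      (by rw [hhia]; omega)) ha (by simpa using hgda) ?_
    intro v hv
    rcases eq_or_ne v a with rfl | hva
    · simpa using hgda.le
    · simp [Function.update_of_ne hva]

/-- Positions between the left end of the gap and a right-crossing leaf. -/
theorem Opt.right (h : Comb D b) (ho : Opt D b r f) {a : V} (ha : D.K a = Kd.il)
    (hc : (D.ix a + 1) * b < f a) {p : ℤ} (hp1 : p < f a) (hp2 : D.ix a * b ≤ p) :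
    ∃ u, f u = p ∧ ((D.K u = Kd.il ∧ D.ix u = D.ix a) ∨ D.hi u ≤ D.ix a + 1) := by
  classical
  have hb := h.bpos
  have hloa : D.lo a = D.ix a - 1 := by simp [Dat.lo, ha, loF]
  have hhia : D.hi a = D.ix a + 2 := by simp [Dat.hi, ha, hiF]
  have hwa := ho.feas.2 a
  rw [hloa, hhia] at hwa
  have e1 : (D.ix a - 1) * b = D.ix a * b - b := by ring
  have e2 : (D.ix a + 2) * b = D.ix a * b + 2 * b := by ring
  have e3 : (D.ix a + 1) * b = D.ix a * b + b := by ring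
  have hgda : gd b (D.ix a) p < gd b (D.ix a) (f a) := by
    unfold gd; omega
  by_contra hcon
  push Not at hcon
  by_cases hex : ∃ u, f u = p
  · obtain ⟨u, hu⟩ := hex
    obtain ⟨hu1, hu2⟩ := hcon u hu
    have hwu := ho.feas.2 u
    have h3 : (D.ix a + 2) * b ≤ D.hi u * b := mul_le_mul_of_nonneg_right (by omega) (by omega)
    have hau : u ≠ a := by rintro rfl; omega
    refine ho.no_improve (a := a) (ho.feas.swap (a := a) (u := u) (by rw [hloa]; omega)
      (by rw [hhia]; omega) (by omega) (by omega)) ha (by simpa [hu] using hgda) ?_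
    intro v hv
    rcases eq_or_ne v a with rfl | hva
    · simpa [hu] using hgda.le
    rcases eq_or_ne v u with rfl | hvu
    · simp only [Equiv.swap_apply_right]
      have hlov : D.hi v = D.ix v + 2 := by simp [Dat.hi, hv, hiF]
      have h5 := hu1 hv
      have h4 : (D.ix a + 2) * b ≤ (D.ix v + 1) * b :=
        mul_le_mul_of_nonneg_right (by omega) (by omega)
      have e5 : (D.ix v + 1) * b = D.ix v * b + b := by ring
      unfold gd; omega
    · simp [Equiv.swap_apply_of_ne_of_ne hva hvu]
  · push Not at hex
    refine ho.no_improve (a := a) (ho.feas.move (a := a) hex (by rw [hloa]; omega)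
      (by rw [hhia]; omega)) ha (by simpa using hgda) ?_
    intro v hv
    rcases eq_or_ne v a with rfl | hva
    · simpa using hgda.le
    · simp [Function.update_of_ne hva]

/-- Leaves of the same clique are sorted by their owners. -/
theorem Opt.sorted (ho : Opt D b r f) {a c : V} (ha : D.K a = Kd.il) (hc : D.K c = Kd.il)
    (hix : D.ix a = D.ix c) (hr : r (D.ow a) < r (D.ow c)) : f a < f c := by
  classical
  by_contra hcon
  have hne : a ≠ c := by rintro rfl; omega
  have hne' : f a ≠ f c := fun e => hne (ho.feas.1 e)
  have hlt : f c < f a := by omega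
  have hlo : D.lo a = D.lo c := by simp [Dat.lo, ha, hc, hix]
  have hhi : D.hi a = D.hi c := by simp [Dat.hi, ha, hc, hix]
  have wa := ho.feas.2 a
  have wc := ho.feas.2 c
  have hg : Feas D b (fun v => f (Equiv.swap a c v)) :=
    ho.feas.swap (by rw [hlo]; exact wc.1) (by rw [hhi]; exact wc.2) (by rw [← hlo]; exact wa.1)
      (by rw [← hhi]; exact wa.2)
  have hp : pot1 D b (fun v => f (Equiv.swap a c v)) = pot1 D b f := by
    unfold pot1
    refine Fintype.sum_equiv (Equiv.swap a c) _ _ ?_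
    intro v
    rcases eq_or_ne v a with rfl | hva
    · simp [ha, hc, hix]
    rcases eq_or_ne v c with rfl | hvc
    · simp [ha, hc, hix]
    · simp [Equiv.swap_apply_of_ne_of_ne hva hvc]
  have h2 := ho.min2 _ hg hp
  unfold pot2 at h2
  rw [← Finset.sum_erase_add _ _ (Finset.mem_univ a),
    ← Finset.sum_erase_add _ _ (Finset.mem_erase.2 ⟨hne.symm, Finset.mem_univ c⟩),
    ← Finset.sum_erase_add _ _ (Finset.mem_univ a),
    ← Finset.sum_erase_add _ _ (Finset.mem_erase.2 ⟨hne.symm, Finset.mem_univ c⟩)] at h2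
  have h3 : ∑ x ∈ (Finset.univ.erase a).erase c,
      (if D.K x = Kd.il then -(r (D.ow x) * f (Equiv.swap a c x)) else 0) =
      ∑ x ∈ (Finset.univ.erase a).erase c, (if D.K x = Kd.il then -(r (D.ow x) * f x) else 0) := by
    apply Finset.sum_congr rfl
    intro x hx
    simp only [mem_erase, mem_univ, and_true] at hx
    rw [Equiv.swap_apply_of_ne_of_ne hx.2 hx.1]
  rw [h3] at h2
  simp only [ha, hc, if_true, Equiv.swap_apply_left, Equiv.swap_apply_right] at h2
  nlinarith [mul_pos (sub_pos.2 hr) (sub_pos.2 hlt)]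

end

section
variable {V : Type*} [Fintype V] {D : Dat V} {b : ℤ} {r f : V → ℤ}

theorem Opt.cut_pos (ho : Opt D b r f) {c : V} (hc : D.K c = Kd.cut) : f c = D.ix c * b := by
  have := ho.feas.2 c
  simp only [Dat.lo, Dat.hi, hc, loF, hiF] at this
  omega

theorem Opt.int_pos (h : Comb D b) (ho : Opt D b r f) {w : V} (hw : D.K w = Kd.int) :
    D.ix w * b < f w ∧ f w < D.ix w * b + b := by
  have h1 := ho.feas.2 w
  simp only [Dat.lo, Dat.hi, hw, loF, hiF] at h1
  obtain ⟨⟨c, hc, hc'⟩, ⟨d, hd, hd'⟩⟩ := h.int_cut w hw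
  have h2 := ho.cut_pos hc
  have h3 := ho.cut_pos hd
  rw [hc'] at h2
  rw [hd'] at h3
  have e : (D.ix w + 1) * b = D.ix w * b + b := by ring
  have h4 : f w ≠ f c := fun e => by
    have := ho.feas.1 e; rw [this, hc] at hw; cases hw
  have h5 : f w ≠ f d := fun e => by
    have := ho.feas.1 e; rw [this, hd] at hw; cases hw
  omega

theorem Opt.il_pos (h : Comb D b) (ho : Opt D b r f) {w : V} (hw : D.K w = Kd.il) :
    D.ix w * b - b < f w ∧ f w < D.ix w * b + 2 * b := by
  have h1 := ho.feas.2 w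
  simp only [Dat.lo, Dat.hi, hw, loF, hiF] at h1
  obtain ⟨⟨c, hc, hc'⟩, ⟨d, hd, hd'⟩⟩ := h.il_cut w hw
  have h2 := ho.cut_pos hc
  have h3 := ho.cut_pos hd
  rw [hc'] at h2
  rw [hd'] at h3
  have e : (D.ix w - 1) * b = D.ix w * b - b := by ring
  have e' : (D.ix w + 2) * b = D.ix w * b + 2 * b := by ring
  have h4 : f w ≠ f c := fun e => by
    have := ho.feas.1 e; rw [this, hc] at hw; cases hw
  have h5 : f w ≠ f d := fun e => by
    have := ho.feas.1 e; rw [this, hd] at hw; cases hw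
  omega

/-- `a` is a leaf of `w` that sits to the left of the gap of `w`. -/
def LL (D : Dat V) (b : ℤ) (f : V → ℤ) (w a : V) : Prop :=
  D.K a = Kd.il ∧ D.ow a = w ∧ f a < D.ix a * b

/-- `a` is a leaf of `w` that sits to the right of the gap of `w`. -/
def RR (D : Dat V) (b : ℤ) (f : V → ℤ) (w a : V) : Prop :=
  D.K a = Kd.il ∧ D.ow a = w ∧ (D.ix a + 1) * b < f a

theorem LL.ix (h : Comb D b) {w a : V} (ha : LL D b f w a) : D.ix a = D.ix w := by
  rw [← ha.2.1]; exact (h.il_ow a ha.1).2.symm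

theorem RR.ix (h : Comb D b) {w a : V} (ha : RR D b f w a) : D.ix a = D.ix w := by
  rw [← ha.2.1]; exact (h.il_ow a ha.1).2.symm

theorem Opt.strad (h : Comb D b) (ho : Opt D b r f) (hr : Function.Injective r) {z a c : V}
    (hz : D.K z = Kd.int) (ha : LL D b f z a) (hc : RR D b f z c) : f c - f a ≤ 2 * b := by
  classical
  have hb := h.bpos
  have hia := ha.ix h
  have hic := hc.ix h
  obtain ⟨ha1, ha2, ha3⟩ := ha
  obtain ⟨hc1, hc2, hc3⟩ := hc
  set m := D.ix z with hm
  rw [hia] at ha3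
  rw [hic] at hc3
  have e3 : (m + 1) * b = m * b + b := by ring
  set A := (Finset.univ : Finset V).filter (fun v => D.K v = Kd.int ∧ D.ix v = m) with hA
  set B := (Finset.univ : Finset V).filter (fun v => D.K v = Kd.il ∧ D.ow v = z) with hB
  have hst := h.star z hz A B (fun v hv => by simpa [hA] using hv) (fun v hv => by simpa [hB] using hv)
  have hown : ∀ u, D.K u = Kd.il → D.ix u = m → f a < f u → f u < f c → D.ow u = z := by
    intro u hu hum h1 h2
    apply hr
    rcases lt_trichotomy (r (D.ow u)) (r z) with h3 | h3 | h3
    · have := ho.sorted hu ha1 (hum.trans hia.symm) (by rw [ha2]; exact h3)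
      omega
    · exact h3
    · have := ho.sorted hc1 hu (hic.trans hum.symm) (by rw [hc2]; exact h3)
      omega
  have hsub : Finset.Icc (f a) (f c) ⊆
      (A.image f ∪ B.image f) ∪ {m * b, m * b + b} := by
    intro p hp
    rw [mem_Icc] at hp
    simp only [mem_union, mem_image, mem_insert, mem_singleton]
    rcases eq_or_ne p (f a) with h1 | h1
    · left; right; exact ⟨a, by simp [hB, ha1, ha2], h1.symm⟩
    rcases eq_or_ne p (f c) with h2 | h2
    · left; right; exact ⟨c, by simp [hB, hc1, hc2], h2.symm⟩
    have hil : ∀ u, f u = p → D.K u = Kd.il → D.ix u = m → ∃ a ∈ B, f a = p := by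
      intro u hu hk hi
      exact ⟨u, by simp [hB, hk, hown u hk hi (by omega) (by omega)], hu⟩
    by_cases h3 : p ≤ m * b + b
    · obtain ⟨u, hu, hu'⟩ := ho.left h ha1 (by rw [hia]; exact ha3) (p := p) (by omega)
        (by rw [hia]; omega)
      rw [hia] at hu'
      rcases hu' with hu' | hu'
      · left; right; exact hil u hu hu'.1 hu'.2
      by_cases h4 : m * b ≤ p
      · obtain ⟨u', hv, hv'⟩ := ho.right h hc1 (by rw [hic]; exact hc3) (p := p) (by omega)
          (by rw [hic]; omega)
        obtain rfl : u' = u := ho.feas.1 (hv.trans hu.symm)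
        rw [hic] at hv'
        rcases hv' with hv' | hv'
        · left; right; exact hil _ hu hv'.1 hv'.2
        cases hk : D.K u'
        · have := ho.cut_pos hk
          simp only [Dat.lo, Dat.hi, hk, loF, hiF] at hu' hv'
          right
          rcases (by omega : D.ix u' = m ∨ D.ix u' = m + 1) with h5 | h5
          · left; rw [← hu, this, h5]
          · right; rw [← hu, this, h5]; ring
        · simp only [Dat.lo, Dat.hi, hk, loF, hiF] at hu' hv'
          left; left
          exact ⟨u', by simp [hA, hk]; omega, hu⟩
        · simp only [Dat.lo, Dat.hi, hk, loF, hiF] at hu' hv'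
          omega
        · simp only [Dat.lo, Dat.hi, hk, loF, hiF] at hu' hv'
          omega
      · exfalso
        have h5 := (ho.feas.2 u).1
        have h6 : m * b ≤ D.lo u * b := mul_le_mul_of_nonneg_right hu' (by omega)
        omega
    · obtain ⟨u, hu, hu'⟩ := ho.right h hc1 (by rw [hic]; exact hc3) (p := p) (by omega)
        (by rw [hic]; omega)
      rw [hic] at hu'
      rcases hu' with hu' | hu'
      · left; right; exact hil u hu hu'.1 hu'.2
      · exfalso
        have h5 := (ho.feas.2 u).2
        have h6 : D.hi u * b ≤ (m + 1) * b := mul_le_mul_of_nonneg_right hu' (by omega)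
        omega
  have hcard := Finset.card_le_card hsub
  have h1 := Finset.card_union_le (A.image f ∪ B.image f) {m * b, m * b + b}
  have h2 := Finset.card_union_le (A.image f) (B.image f)
  have h3 : (A.image f).card ≤ A.card := Finset.card_image_le
  have h4 : (B.image f).card ≤ B.card := Finset.card_image_le
  have h5 : ({m * b, m * b + b} : Finset ℤ).card ≤ 2 := Finset.card_le_two
  rw [Int.card_Icc] at hcard
  omega

theorem exists_lo2 (f : V → ℤ) (w : V) : ∃ x : ℤ, D.ix w * b + 1 ≤ x ∧
    (∀ a, RR D b f w a → f a - b ≤ x) ∧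
    (x = D.ix w * b + 1 ∨ ∃ a, RR D b f w a ∧ x = f a - b) := by
  classical
  set S := insert (D.ix w * b + 1)
    (((Finset.univ : Finset V).filter (fun a => RR D b f w a)).image (fun a => f a - b)) with hS
  have hne : S.Nonempty := ⟨_, Finset.mem_insert_self _ _⟩
  refine ⟨S.max' hne, S.le_max' _ (Finset.mem_insert_self _ _), fun a ha => ?_, ?_⟩
  · apply S.le_max'
    rw [hS, mem_insert, mem_image]
    exact Or.inr ⟨a, by simp [ha], rfl⟩
  · have := S.max'_mem hne
    rcases Finset.mem_insert.1 this with h | h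
    · left; exact h
    · obtain ⟨a, ha, h⟩ := Finset.mem_image.1 h
      right; exact ⟨a, by simpa using ha, h.symm⟩

theorem exists_hi2 (f : V → ℤ) (w : V) : ∃ x : ℤ, x ≤ D.ix w * b + b - 1 ∧
    (∀ a, LL D b f w a → x ≤ f a + b) ∧
    (x = D.ix w * b + b - 1 ∨ ∃ a, LL D b f w a ∧ x = f a + b) := by
  classical
  set S := insert (D.ix w * b + b - 1)
    (((Finset.univ : Finset V).filter (fun a => LL D b f w a)).image (fun a => f a + b)) with hS
  have hne : S.Nonempty := ⟨_, Finset.mem_insert_self _ _⟩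
  refine ⟨S.min' hne, S.min'_le _ (Finset.mem_insert_self _ _), fun a ha => ?_, ?_⟩
  · apply S.min'_le
    rw [hS, mem_insert, mem_image]
    exact Or.inr ⟨a, by simp [ha], rfl⟩
  · have := S.min'_mem hne
    rcases Finset.mem_insert.1 this with h | h
    · left; exact h
    · obtain ⟨a, ha, h⟩ := Finset.mem_image.1 h
      right; exact ⟨a, by simpa using ha, h.symm⟩

/-- Leaves of interior vertices outside the gap of their owner. -/
def Cross (D : Dat V) (b : ℤ) (f : V → ℤ) (v : V) : Prop :=
  D.K v = Kd.il ∧ (f v < D.ix v * b ∨ (D.ix v + 1) * b < f v)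

theorem card_le_of_map {C : Finset V} {s t : ℤ} (hst : s ≤ t) (g : V → ℤ) (hg : Set.InjOn g C)
    (h : ∀ v ∈ C, s ≤ g v ∧ g v ≤ t) : (C.card : ℤ) ≤ t + 1 - s := by
  classical
  have h1 : (C.image g).card = C.card := Finset.card_image_of_injOn hg
  have h2 : C.image g ⊆ Finset.Icc s t := by
    intro x hx
    rw [mem_image] at hx
    obtain ⟨v, hv, rfl⟩ := hx
    rw [mem_Icc]; exact h v hv
  have h3 := Finset.card_le_card h2
  rw [Int.card_Icc] at h3
  omega

theorem Opt.gap (h : Comb D b) (ho : Opt D b r f) (hr : Function.Injective r) (m : ℤ) :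
    ∃ g : V → ℤ, (∀ u v, m * b < f u → f u < m * b + b → m * b < f v → f v < m * b + b →
      g u = g v → u = v) ∧
    ∀ v, m * b < f v → f v < m * b + b → (m * b < g v ∧ g v < m * b + b) ∧
      (Cross D b f v → g v = f v) ∧
      (D.K v = Kd.int → (∀ a, LL D b f v a → g v ≤ f a + b) ∧
        (∀ a, RR D b f v a → f a - b ≤ g v)) := by
  classical
  have hb := h.bpos
  have hinj : Function.Injective f := ho.feas.1
  choose lo2 hlo1 hlo2 hlo3 using exists_lo2 (D := D) (b := b) f
  choose hi2 hhi1 hhi2 hhi3 using exists_hi2 (D := D) (b := b) f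
  set S := (Finset.univ : Finset V).filter (fun v => m * b < f v ∧ f v < m * b + b) with hS
  have hSm : ∀ v, v ∈ S ↔ m * b < f v ∧ f v < m * b + b := fun v => by simp [hS]
  have e3 : (m + 1) * b = m * b + b := by ring
  have e4 : (m + 2) * b = m * b + 2 * b := by ring
  set lo' : V → ℤ := fun v => if Cross D b f v then f v else if D.K v = Kd.int then lo2 v
    else m * b + 1 with hlo'
  set hi' : V → ℤ := fun v => if Cross D b f v then f v else if D.K v = Kd.int then hi2 v
    else m * b + b - 1 with hhi'
  have hnc : ∀ v, D.K v = Kd.int → ¬ Cross D b f v := by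
    intro v hv hc
    rw [hc.1] at hv; cases hv
  have hixm : ∀ v ∈ S, D.K v = Kd.int → D.ix v = m := by
    intro v hv hk
    have h1 := ho.int_pos h hk
    have h2 := (hSm v).1 hv
    have h3 : D.ix v * b < (m + 1) * b := by omega
    have h4 : m * b < (D.ix v + 1) * b := by
      have : (D.ix v + 1) * b = D.ix v * b + b := by ring
      omega
    have h5 := lt_of_mul_lt_mul_right h3 (by omega)
    have h6 := lt_of_mul_lt_mul_right h4 (by omega)
    omega
  have hLL : ∀ w ∈ S, D.K w = Kd.int → ∀ a, LL D b f w a → m * b - b < f a ∧ f a < m * b ∧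
      D.ix a = m ∧ D.K a = Kd.il := by
    intro w hw hk a ha
    have h1 := ha.ix h
    rw [hixm w hw hk] at h1
    have h2 := ho.il_pos h ha.1
    have h3 := ha.2.2
    rw [h1] at h2 h3
    exact ⟨h2.1, h3, h1, ha.1⟩
  have hRR : ∀ w ∈ S, D.K w = Kd.int → ∀ a, RR D b f w a → m * b + b < f a ∧ f a < m * b + 2 * b ∧
      D.ix a = m ∧ D.K a = Kd.il := by
    intro w hw hk a ha
    have h1 := ha.ix h
    rw [hixm w hw hk] at h1
    have h2 := ho.il_pos h ha.1
    have h3 := ha.2.2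
    rw [h1] at h2 h3
    exact ⟨by omega, h2.2, h1, ha.1⟩
  -- a crossing leaf in the gap, when the gap itself has a left-crossing leaf
  have hcl : ∀ v ∈ S, Cross D b f v → ∀ a, D.K a = Kd.il → D.ix a = m → f a < m * b →
      m ≤ D.lo v := by
    intro v hv hc a ha hia hfa
    have h2 := (hSm v).1 hv
    obtain ⟨u, hu, hu'⟩ := ho.left h ha (by rw [hia]; exact hfa) (p := f v) (by omega)
      (by rw [hia]; omega)
    obtain rfl : u = v := hinj hu
    rw [hia] at hu'
    rcases hu' with hu' | hu'
    · exfalso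
      have := hc.2
      rw [hu'.2] at this
      omega
    · exact hu'
  have hcr : ∀ v ∈ S, Cross D b f v → ∀ a, D.K a = Kd.il → D.ix a = m → m * b + b < f a →
      D.hi v ≤ m + 1 := by
    intro v hv hc a ha hia hfa
    have h2 := (hSm v).1 hv
    obtain ⟨u, hu, hu'⟩ := ho.right h ha (by rw [hia]; omega) (p := f v) (by omega)
      (by rw [hia]; omega)
    obtain rfl : u = v := hinj hu
    rw [hia] at hu'
    rcases hu' with hu' | hu'
    · exfalso
      have := hc.2
      rw [hu'.2] at this
      omega
    · exact hu'
  obtain ⟨g, hg1, hg2⟩ := interval_hall S lo' hi' (by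
    intro v hv
    have hv' := (hSm v).1 hv
    simp only [hlo', hhi']
    split_ifs with h1 h2
    · exact le_rfl
    · have hm := hixm v hv h2
      have h3 := hlo3 v
      have h4 := hhi3 v
      rw [hm] at h3 h4
      rcases h3 with h3 | ⟨c, hc, h3⟩ <;> rcases h4 with h4 | ⟨a, ha, h4⟩
      · omega
      · have := hLL v hv h2 a ha
        omega
      · have := hRR v hv h2 c hc
        omega
      · have := ho.strad h hr h2 ha hc
        omega
    · omega) (by
    intro s t hst
    set C := S.filter (fun v => s ≤ lo' v ∧ hi' v ≤ t) with hC
    have hCS : ∀ v ∈ C, v ∈ S := fun v hv => by rw [hC, mem_filter] at hv; exact hv.1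
    have hCc : ∀ v ∈ C, Cross D b f v → s ≤ f v ∧ f v ≤ t := by
      intro v hv hc
      rw [hC, mem_filter] at hv
      simpa [hlo', hhi', hc] using hv.2
    have hCi : ∀ v ∈ C, D.K v = Kd.int → s ≤ lo2 v ∧ hi2 v ≤ t := by
      intro v hv hc
      rw [hC, mem_filter] at hv
      simpa [hlo', hhi', hnc v hc, hc] using hv.2
    have hCo : ∀ v ∈ C, ¬ Cross D b f v → D.K v ≠ Kd.int → s ≤ m * b + 1 ∧ m * b + b - 1 ≤ t := by
      intro v hv hc hk
      rw [hC, mem_filter] at hv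
      simpa [hlo', hhi', hc, hk] using hv.2
    have useF : (∀ v ∈ C, s ≤ f v ∧ f v ≤ t) → (C.card : ℤ) ≤ t + 1 - s := fun hh =>
      card_le_of_map hst f (hinj.injOn) hh
    by_cases hs : s ≤ m * b + 1 <;> by_cases ht : m * b + b - 1 ≤ t
    · apply useF
      intro v hv
      have := (hSm v).1 (hCS v hv)
      omega
    · -- left types
      have hint : ∀ v ∈ C, ¬ Cross D b f v → D.K v = Kd.int := by
        intro v hv hc
        by_contra hk
        exact ht (hCo v hv hc hk).2
      have hleaf : ∀ v ∈ C, D.K v = Kd.int → ∃ a, LL D b f v a ∧ hi2 v = f a + b := by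
        intro v hv hk
        rcases hhi3 v with h1 | h1
        · exfalso
          rw [hixm v (hCS v hv) hk] at h1
          have := (hCi v hv hk).2
          omega
        · exact h1
      by_cases hx : ∃ v ∈ C, Cross D b f v
      · obtain ⟨v, hv, hvc⟩ := hx
        apply useF
        intro w hw
        by_cases hwc : Cross D b f w
        · exact hCc w hw hwc
        have hk := hint w hw hwc
        have hw' := (hSm w).1 (hCS w hw)
        refine ⟨by omega, ?_⟩
        obtain ⟨a, ha, -⟩ := hleaf w hw hk
        obtain ⟨ha1, ha2, ha3, ha4⟩ := hLL w (hCS w hw) hk a ha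
        have h1 := hcl v (hCS v hv) hvc a ha4 ha3 ha2
        have h2 : D.lo v = D.ix v - 1 := by simp [Dat.lo, hvc.1, loF]
        have h3 : (m + 1) * b ≤ D.ix v * b := mul_le_mul_of_nonneg_right (by omega) (by omega)
        have h4 := (hSm v).1 (hCS v hv)
        have h5 := hCc v hv hvc
        by_contra hcon
        have e5 : (D.ix v + 1) * b = D.ix v * b + b := by ring
        obtain ⟨u, hu, hu'⟩ := ho.left h hvc.1 (by omega) (p := f w) (by omega) (by omega)
        obtain rfl : u = w := hinj hu
        rcases hu' with hu' | hu'
        · rw [hk] at hu'; cases hu'.1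
        · have h6 : D.lo u = D.ix u := by simp [Dat.lo, hk, loF]
          have h7 := hixm u (hCS u hw) hk
          omega
      · push Not at hx
        have hall : ∀ v ∈ C, D.K v = Kd.int := fun v hv => hint v hv (hx v hv)
        apply card_le_of_map hst hi2
        · intro v hv w hw hvw
          obtain ⟨a, ha, ha'⟩ := hleaf v hv (hall v hv)
          obtain ⟨c, hc, hc'⟩ := hleaf w hw (hall w hw)
          have : a = c := hinj (by omega)
          rw [← ha.2.1, ← hc.2.1, this]
        · intro v hv
          obtain ⟨a, ha, ha'⟩ := hleaf v hv (hall v hv)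
          have := hLL v (hCS v hv) (hall v hv) a ha
          have h2 := hCi v hv (hall v hv)
          omega
    · -- right types
      have hint : ∀ v ∈ C, ¬ Cross D b f v → D.K v = Kd.int := by
        intro v hv hc
        by_contra hk
        exact hs (hCo v hv hc hk).1
      have hleaf : ∀ v ∈ C, D.K v = Kd.int → ∃ a, RR D b f v a ∧ lo2 v = f a - b := by
        intro v hv hk
        rcases hlo3 v with h1 | h1
        · exfalso
          rw [hixm v (hCS v hv) hk] at h1
          have := (hCi v hv hk).1
          omega
        · exact h1
      by_cases hx : ∃ v ∈ C, Cross D b f v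
      · obtain ⟨v, hv, hvc⟩ := hx
        apply useF
        intro w hw
        by_cases hwc : Cross D b f w
        · exact hCc w hw hwc
        have hk := hint w hw hwc
        have hw' := (hSm w).1 (hCS w hw)
        refine ⟨?_, by omega⟩
        obtain ⟨a, ha, -⟩ := hleaf w hw hk
        obtain ⟨ha1, ha2, ha3, ha4⟩ := hRR w (hCS w hw) hk a ha
        have h1 := hcr v (hCS v hv) hvc a ha4 ha3 ha1
        have h2 : D.hi v = D.ix v + 2 := by simp [Dat.hi, hvc.1, hiF]
        have h3 : (D.ix v + 1) * b ≤ m * b := mul_le_mul_of_nonneg_right (by omega) (by omega)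
        have h4 := (hSm v).1 (hCS v hv)
        have h5 := hCc v hv hvc
        by_contra hcon
        have e5 : (D.ix v + 1) * b = D.ix v * b + b := by ring
        obtain ⟨u, hu, hu'⟩ := ho.right h hvc.1 (by omega) (p := f w) (by omega) (by omega)
        obtain rfl : u = w := hinj hu
        rcases hu' with hu' | hu'
        · rw [hk] at hu'; cases hu'.1
        · have h6 : D.hi u = D.ix u + 1 := by simp [Dat.hi, hk, hiF]
          have h7 := hixm u (hCS u hw) hk
          omega
      · push Not at hx
        have hall : ∀ v ∈ C, D.K v = Kd.int := fun v hv => hint v hv (hx v hv)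
        apply card_le_of_map hst lo2
        · intro v hv w hw hvw
          obtain ⟨a, ha, ha'⟩ := hleaf v hv (hall v hv)
          obtain ⟨c, hc, hc'⟩ := hleaf w hw (hall w hw)
          have : a = c := hinj (by omega)
          rw [← ha.2.1, ← hc.2.1, this]
        · intro v hv
          obtain ⟨a, ha, ha'⟩ := hleaf v hv (hall v hv)
          have := hRR v (hCS v hv) (hall v hv) a ha
          have h2 := hCi v hv (hall v hv)
          omega
    · -- straddlers
      have hint : ∀ v ∈ C, ¬ Cross D b f v → D.K v = Kd.int := by
        intro v hv hc
        by_contra hk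
        exact hs (hCo v hv hc hk).1
      by_cases hz : ∃ z ∈ C, D.K z = Kd.int
      · obtain ⟨z, hz, hzk⟩ := hz
        have hleafL : ∀ v ∈ C, D.K v = Kd.int → ∃ a, LL D b f v a := by
          intro v hv hk
          rcases hhi3 v with h1 | ⟨a, ha, -⟩
          · exfalso
            rw [hixm v (hCS v hv) hk] at h1
            have := (hCi v hv hk).2
            omega
          · exact ⟨a, ha⟩
        have hleafR : ∀ v ∈ C, D.K v = Kd.int → ∃ a, RR D b f v a := by
          intro v hv hk
          rcases hlo3 v with h1 | ⟨a, ha, -⟩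
          · exfalso
            rw [hixm v (hCS v hv) hk] at h1
            have := (hCi v hv hk).1
            omega
          · exact ⟨a, ha⟩
        have hord : ∀ u ∈ C, ∀ v ∈ C, D.K u = Kd.int → D.K v = Kd.int → ¬ r u < r v := by
          intro u hu v hv hku hkv hlt
          obtain ⟨c, hc⟩ := hleafR u hu hku
          obtain ⟨a, ha⟩ := hleafL v hv hkv
          have h1 := hRR u (hCS u hu) hku c hc
          have h2 := hLL v (hCS v hv) hkv a ha
          have := ho.sorted h1.2.2.2 h2.2.2.2 (h1.2.2.1.trans h2.2.2.1.symm)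
            (by rw [hc.2.1, ha.2.1]; exact hlt)
          omega
        have hsub : C ⊆ {z} := by
          intro v hv
          rw [mem_singleton]
          by_cases hvc : Cross D b f v
          · exfalso
            obtain ⟨a, ha⟩ := hleafL z hz hzk
            obtain ⟨c, hc⟩ := hleafR z hz hzk
            obtain ⟨ha1, ha2, ha3, ha4⟩ := hLL z (hCS z hz) hzk a ha
            obtain ⟨hc1, hc2, hc3, hc4⟩ := hRR z (hCS z hz) hzk c hc
            have h1 := hcl v (hCS v hv) hvc a ha4 ha3 ha2
            have h2 := hcr v (hCS v hv) hvc c hc4 hc3 hc1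
            simp only [Dat.lo, Dat.hi, hvc.1, loF, hiF] at h1 h2
            omega
          · have hk := hint v hv hvc
            have h1 := hord v hv z hz hk hzk
            have h2 := hord z hz v hv hzk hk
            exact hr (by omega)
        have := Finset.card_le_card hsub
        rw [Finset.card_singleton] at this
        omega
      · push Not at hz
        apply useF
        intro v hv
        by_cases hvc : Cross D b f v
        · exact hCc v hv hvc
        · exact absurd (hint v hv hvc) (hz v hv))
  refine ⟨g, fun u v h1 h2 h3 h4 he => hg1 ((hSm u).2 ⟨h1, h2⟩) ((hSm v).2 ⟨h3, h4⟩) he, ?_⟩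
  intro v hv1 hv2
  have hvS := (hSm v).2 ⟨hv1, hv2⟩
  have hw := hg2 v hvS
  simp only [hlo', hhi'] at hw
  by_cases hc : Cross D b f v
  · simp only [hc, if_true] at hw
    refine ⟨by omega, fun _ => by omega, fun hk => absurd hc (hnc v hk)⟩
  · by_cases hk : D.K v = Kd.int
    · simp only [hc, hk, if_true, if_false] at hw
      have h1 := hlo1 v
      have h2 := hhi1 v
      rw [hixm v hvS hk] at h1 h2
      refine ⟨by omega, fun hc' => absurd hc' hc, fun _ => ⟨fun a ha => ?_, fun a ha => ?_⟩⟩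
      · have := hhi2 v a ha; omega
      · have := hlo2 v a ha; omega
    · simp only [hc, hk, if_false] at hw
      exact ⟨by omega, fun hc' => absurd hc' hc, fun hk' => absurd hk' hk⟩

end

/-- The main combinatorial theorem. -/
theorem exists_labeling {V : Type*} [Fintype V] {D : Dat V} {b : ℤ} (h : Comb D b) :
    ∃ g : V → ℤ, Feas D b g ∧ ∀ a, D.K a = Kd.il → |g a - g (D.ow a)| ≤ b := by
  classical
  have hb := h.bpos
  obtain ⟨r, hr⟩ : ∃ r : V → ℤ, Function.Injective r :=
    ⟨fun v => ((Fintype.equivFin V v : ℕ) : ℤ), fun u v huv => by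
      exact (Fintype.equivFin V).injective (Fin.ext (Int.ofNat.inj huv))⟩
  obtain ⟨f, ho⟩ := exists_opt h r
  choose g hg1 hg2 using ho.gap h hr
  have hinj : Function.Injective f := ho.feas.1
  set G : V → ℤ := fun v => if b ∣ f v then f v else g (f v / b) v with hG
  have hopen : ∀ v m, m * b < f v → f v < m * b + b → G v = g m v := by
    intro v m h1 h2
    have hdiv : f v / b = m := by
      rw [Int.ediv_eq_iff_of_pos (by omega)]
      constructor <;> nlinarith
    have hnd : ¬ b ∣ f v := by
      rintro ⟨c, hc⟩
      rw [hc, mul_comm b c] at h1 h2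
      have h3 := lt_of_mul_lt_mul_right h1 (by omega)
      have h4 : c * b < (m + 1) * b := by linarith
      have h5 := lt_of_mul_lt_mul_right h4 (by omega)
      omega
    simp only [hG, hnd, if_false, hdiv]
  have hclosed : ∀ v, b ∣ f v → G v = f v := fun v hv => by simp only [hG, hv, if_true]
  have hcase : ∀ v, b ∣ f v ∨ ∃ m, m * b < f v ∧ f v < m * b + b := by
    intro v
    by_cases hd : b ∣ f v
    · exact Or.inl hd
    · right
      refine ⟨f v / b, ?_, ?_⟩
      · have h1 := Int.ediv_mul_le (f v) (show b ≠ 0 by omega)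
        rcases eq_or_lt_of_le h1 with h2 | h2
        · exact absurd ⟨f v / b, by rw [mul_comm]; exact h2.symm⟩ hd
        · exact h2
      · have := Int.lt_ediv_add_one_mul_self (f v) (show 0 < b by omega)
        linarith
  have hGo : ∀ v m, m * b < f v → f v < m * b + b → m * b < G v ∧ G v < m * b + b := by
    intro v m h1 h2
    rw [hopen v m h1 h2]
    exact (hg2 m v h1 h2).1
  have hbet : ∀ c m x : ℤ, x = b * c → m * b < x → x < m * b + b → False := by
    intro c m x hx h1 h2
    rw [hx, mul_comm b c] at h1 h2
    have h3 := lt_of_mul_lt_mul_right h1 (by omega)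
    have h4 : c * b < (m + 1) * b := by linarith
    have h5 := lt_of_mul_lt_mul_right h4 (by omega)
    omega
  refine ⟨G, ⟨?_, ?_⟩, ?_⟩
  · intro u v huv
    rcases hcase u with hu | ⟨m, hu1, hu2⟩ <;> rcases hcase v with hv | ⟨n, hv1, hv2⟩
    · rw [hclosed u hu, hclosed v hv] at huv
      exact hinj huv
    · exfalso
      obtain ⟨c, hc⟩ := hu
      have := hGo v n hv1 hv2
      rw [← huv, hclosed u ⟨c, hc⟩] at this
      exact hbet c n _ hc this.1 this.2
    · exfalso
      obtain ⟨c, hc⟩ := hv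
      have := hGo u m hu1 hu2
      rw [huv, hclosed v ⟨c, hc⟩] at this
      exact hbet c m _ hc this.1 this.2
    · have h1 := hGo u m hu1 hu2
      have h2 := hGo v n hv1 hv2
      rw [huv] at h1
      have h3 : m * b < (n + 1) * b := by linarith
      have h4 : n * b < (m + 1) * b := by linarith
      have h5 := lt_of_mul_lt_mul_right h3 (by omega)
      have h6 := lt_of_mul_lt_mul_right h4 (by omega)
      obtain rfl : m = n := by omega
      rw [hopen u m hu1 hu2, hopen v m hv1 hv2] at huv
      exact hg1 m u v hu1 hu2 hv1 hv2 huv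
  · intro v
    have hw := ho.feas.2 v
    rcases hcase v with hv | ⟨m, h1, h2⟩
    · rw [hclosed v hv]; exact hw
    · have h3 := hGo v m h1 h2
      have h4 : D.lo v * b < (m + 1) * b := by linarith
      have h5 : m * b < D.hi v * b := by linarith
      have h6 := lt_of_mul_lt_mul_right h4 (by omega)
      have h7 := lt_of_mul_lt_mul_right h5 (by omega)
      have h8 : D.lo v * b ≤ m * b := mul_le_mul_of_nonneg_right (by omega) (by omega)
      have h9 : (m + 1) * b ≤ D.hi v * b := mul_le_mul_of_nonneg_right (by omega) (by omega)
      constructor <;> linarith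
  · intro a ha
    obtain ⟨hk, hix⟩ := h.il_ow a ha
    have hw := ho.int_pos h hk
    rw [hix] at hw
    have ha' := ho.il_pos h ha
    set m := D.ix a with hm
    have hgw := hg2 m (D.ow a) hw.1 hw.2
    have hGw := hopen _ m hw.1 hw.2
    have e3 : (m + 1) * b = m * b + b := by ring
    have hcr : Cross D b f a → G a = f a := by
      intro hc
      rcases hcase a with hd | ⟨n, h1, h2⟩
      · exact hclosed a hd
      · rw [hopen a n h1 h2]
        exact (hg2 n a h1 h2).2.1 hc
    rw [abs_le]
    by_cases hL : f a < m * b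
    · have h1 := (hgw.2.2 hk).1 a ⟨ha, rfl, hL⟩
      rw [hcr ⟨ha, Or.inl hL⟩, hGw]
      omega
    by_cases hR : (m + 1) * b < f a
    · have h1 := (hgw.2.2 hk).2 a ⟨ha, rfl, hR⟩
      rw [hcr ⟨ha, Or.inr hR⟩, hGw]
      omega
    rw [hGw]
    have h2 : m * b ≤ G a ∧ G a ≤ m * b + b := by
      rcases eq_or_ne (f a) (m * b) with h3 | h3
      · rw [hclosed a ⟨m, by rw [h3]; ring⟩]; omega
      rcases eq_or_ne (f a) (m * b + b) with h4 | h4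
      · rw [hclosed a ⟨m + 1, by rw [h4]; ring⟩]; omega
      have := hGo a m (by omega) (by omega)
      omega
    omega

section Graph
variable {V : Type*}

/-- `u` and `v` are at distance at most `d` inside the induced graph on `S`. -/
def Near (G : SimpleGraph V) (S : Set V) (u v : V) (d : ℤ) : Prop :=
  ∃ (hu : u ∈ S) (hv : v ∈ S) (n : ℕ), (n : ℤ) ≤ d ∧
    (G.induce S).edist ⟨u, hu⟩ ⟨v, hv⟩ ≤ (n : ℕ∞)

theorem Near.refl (G : SimpleGraph V) {S : Set V} {u : V} (hu : u ∈ S) : Near G S u u 0 :=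
  ⟨hu, hu, 0, by simp, by simp⟩

theorem Near.adj {G : SimpleGraph V} {S : Set V} {u v : V} (hu : u ∈ S) (hv : v ∈ S)
    (h : G.Adj u v) : Near G S u v 1 := by
  refine ⟨hu, hv, 1, by simp, ?_⟩
  have : (G.induce S).Adj ⟨u, hu⟩ ⟨v, hv⟩ := by simpa using h
  rw [Nat.cast_one, SimpleGraph.edist_le_one_iff_adj_or_eq]
  exact Or.inl this

theorem Near.symm {G : SimpleGraph V} {S : Set V} {u v : V} {d : ℤ} (h : Near G S u v d) :
    Near G S v u d := by
  obtain ⟨hu, hv, n, h1, h2⟩ := h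
  exact ⟨hv, hu, n, h1, by rw [SimpleGraph.edist_comm]; exact h2⟩

theorem Near.trans {G : SimpleGraph V} {S : Set V} {u v w : V} {d e : ℤ} (h : Near G S u v d)
    (h' : Near G S v w e) : Near G S u w (d + e) := by
  obtain ⟨hu, hv, n, h1, h2⟩ := h
  obtain ⟨_, hw, m, h3, h4⟩ := h'
  refine ⟨hu, hw, n + m, by push_cast; omega, ?_⟩
  push_cast
  exact (SimpleGraph.edist_triangle (v := ⟨v, hv⟩)).trans (add_le_add h2 h4)

theorem Near.mono {G : SimpleGraph V} {S : Set V} {u v : V} {d e : ℤ} (h : Near G S u v d)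
    (hde : d ≤ e) : Near G S u v e := by
  obtain ⟨hu, hv, n, h1, h2⟩ := h
  exact ⟨hu, hv, n, by omega, h2⟩

theorem edge_le_bwOf [Fintype V] (G : SimpleGraph V) (f : V → ℤ) {u v : V} (h : G.Adj u v) :
    (f u - f v).natAbs ≤ bwOf G f := by
  refine le_csSup ?_ ⟨u, v, h, rfl⟩
  have : Set.Finite (Set.range (fun p : V × V => (f p.1 - f p.2).natAbs)) := Set.finite_range _
  refine (this.subset ?_).bddAbove
  rintro n ⟨u, v, _, rfl⟩
  exact ⟨(u, v), rfl⟩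

theorem bandwidth_attained [Fintype V] (G : SimpleGraph V) :
    ∃ f : V → ℤ, Function.Injective f ∧ bandwidth G = bwOf G f := by
  have : {n | ∃ f : V → ℤ, Function.Injective f ∧ n = bwOf G f}.Nonempty := by
    refine ⟨_, fun v => ((Fintype.equivFin V v : ℕ) : ℤ), fun u v huv => ?_, rfl⟩
    exact (Fintype.equivFin V).injective (Fin.ext (Int.ofNat.inj huv))
  exact Nat.sInf_mem this

theorem walk_bound (G : SimpleGraph V) (f : V → ℤ) (B : ℕ)
    (h : ∀ u v, G.Adj u v → (f u - f v).natAbs ≤ B) {u v : V} (p : G.Walk u v) :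
    f v - f u ≤ p.length * B := by
  induction p with
  | nil => simp
  | cons hadj p ih =>
    have := h _ _ hadj
    rw [SimpleGraph.Walk.length_cons]
    push_cast
    rw [add_mul]
    omega

theorem dens_le_bandwidth [Fintype V] (G : SimpleGraph V) (H : G.Subgraph)
    (hc : H.coe.Connected) (h2 : 2 ≤ H.verts.ncard) :
    (H.verts.ncard - 1) ⌈/⌉ H.coe.diam ≤ bandwidth G := by
  classical
  obtain ⟨f, hf, hB⟩ := bandwidth_attained G
  have hnt : Nontrivial H.verts := by
    obtain ⟨x, hx, y, hy, hxy⟩ := (Set.one_lt_ncard_iff_nontrivial).1 h2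
    exact ⟨⟨x, hx⟩, ⟨y, hy⟩, fun h => hxy (congrArg Subtype.val h)⟩
  have hd : H.coe.diam ≠ 0 := SimpleGraph.connected_iff_diam_ne_zero.1 hc
  have hed : H.coe.ediam ≠ ⊤ := SimpleGraph.ediam_ne_top_of_diam_ne_zero hd
  rw [ceilDiv_le_iff_le_mul (Nat.pos_of_ne_zero hd)]
  have hne : (Finset.univ : Finset H.verts).Nonempty := Finset.univ_nonempty
  obtain ⟨u, _, hu⟩ := Finset.exists_min_image _ (fun x : H.verts => f x) hne
  obtain ⟨v, _, hv⟩ := Finset.exists_max_image _ (fun x : H.verts => f x) hne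
  obtain ⟨p, hp⟩ := hc.exists_walk_length_eq_dist u v
  have h3 := walk_bound H.coe (fun x => f x) (bandwidth G) (fun x y hxy => by
    rw [hB]; exact edge_le_bwOf G f (H.coe_adj_sub _ _ hxy)) p
  have h4 : p.length ≤ H.coe.diam := hp ▸ SimpleGraph.dist_le_diam hed
  have h5 : (H.verts.ncard : ℤ) ≤ f v + 1 - f u := by
    have h6 : (H.verts.toFinset.image f) ⊆ Finset.Icc (f u) (f v) := by
      intro n hn
      obtain ⟨x, hx, rfl⟩ := Finset.mem_image.1 hn
      have hx' : x ∈ H.verts := by simpa using hx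
      exact Finset.mem_Icc.2 ⟨hu ⟨x, hx'⟩ (Finset.mem_univ _), hv ⟨x, hx'⟩ (Finset.mem_univ _)⟩
    have h7 := Finset.card_le_card h6
    rw [Finset.card_image_of_injective _ hf, Int.card_Icc, ← Set.ncard_eq_toFinset_card'] at h7
    omega
  have h8 : ((p.length * bandwidth G : ℕ) : ℤ) ≤ ((H.coe.diam * bandwidth G : ℕ) : ℤ) := by
    exact_mod_cast Nat.mul_le_mul_right _ h4
  push_cast at h8
  have h9 : (H.verts.ncard : ℤ) ≤ H.coe.diam * bandwidth G + 1 := by linarith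
  have h10 : H.verts.ncard ≤ H.coe.diam * bandwidth G + 1 := by exact_mod_cast h9
  omega

theorem localDensity_le [Fintype V] (G : SimpleGraph V) : localDensity G ≤ bandwidth G := by
  refine csSup_le' ?_
  rintro d ⟨H, hc, h2, rfl⟩
  exact dens_le_bandwidth G H hc h2

theorem le_localDensity [Fintype V] (G : SimpleGraph V) (H : G.Subgraph)
    (hc : H.coe.Connected) (h2 : 2 ≤ H.verts.ncard) :
    (H.verts.ncard - 1) ⌈/⌉ H.coe.diam ≤ localDensity G := by
  refine le_csSup ⟨bandwidth G, ?_⟩ ⟨H, hc, h2, rfl⟩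
  rintro d ⟨H, hc, h2, rfl⟩
  exact dens_le_bandwidth G H hc h2

theorem card_le_of_near [Fintype V] (G : SimpleGraph V) (S : Set V) (d : ℤ) (hd : 1 ≤ d)
    (h : ∀ u ∈ S, ∀ v ∈ S, Near G S u v d) :
    (S.ncard : ℤ) ≤ d * localDensity G + 1 := by
  classical
  by_cases h2 : 2 ≤ S.ncard
  swap
  · have : 0 ≤ d * (localDensity G : ℤ) := by positivity
    omega
  have hne : S.Nonempty := by
    rw [Set.nonempty_iff_ne_empty]; rintro rfl; simp at h2
  obtain ⟨D, rfl⟩ : ∃ D : ℕ, d = D := ⟨d.toNat, by omega⟩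
  have hH : ((⊤ : G.Subgraph).induce S).coe.ediam ≤ D := by
    apply SimpleGraph.ediam_le_of_edist_le
    rintro ⟨u, hu⟩ ⟨v, hv⟩
    obtain ⟨_, _, n, h1, h2⟩ := h u hu v hv
    rw [← SimpleGraph.induce_eq_coe_induce_top]
    refine h2.trans ?_
    exact_mod_cast h1
  have hnt : ((⊤ : G.Subgraph).induce S).coe.ediam ≠ ⊤ := ne_top_of_le_ne_top (by simp) hH
  have : Nonempty ((⊤ : G.Subgraph).induce S).verts := hne.to_subtype
  have hc := SimpleGraph.connected_of_ediam_ne_top hnt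
  have hle := le_localDensity G ((⊤ : G.Subgraph).induce S) hc h2
  have : Nontrivial ((⊤ : G.Subgraph).induce S).verts := by
    obtain ⟨x, hx, y, hy, hxy⟩ := (Set.one_lt_ncard_iff_nontrivial).1 h2
    exact ⟨⟨x, hx⟩, ⟨y, hy⟩, fun h => hxy (congrArg Subtype.val h)⟩
  have hd0 := SimpleGraph.connected_iff_diam_ne_zero.1 hc
  rw [ceilDiv_le_iff_le_mul (Nat.pos_of_ne_zero hd0)] at hle
  have h3 : ((⊤ : G.Subgraph).induce S).coe.diam ≤ D := by
    unfold SimpleGraph.diam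
    exact ENat.toNat_le_of_le_natCast hH
  have h4 := hle.trans (Nat.mul_le_mul_right _ h3)
  have h5 : S.ncard ≤ D * localDensity G + 1 := by
    change S.ncard - 1 ≤ _ at h4
    omega
  exact_mod_cast h5

theorem one_le_localDensity [Fintype V] (G : SimpleGraph V) {u v : V} (h : G.Adj u v) :
    1 ≤ localDensity G := by
  have huv := h.ne
  have := card_le_of_near G {u, v} 1 le_rfl (by
    have hu : u ∈ ({u, v} : Set V) := by simp
    have hv : v ∈ ({u, v} : Set V) := by simp
    rintro x (rfl | rfl) y (rfl | rfl)
    · exact (Near.refl G hu).mono (by simp)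
    · exact Near.adj hu hv h
    · exact Near.adj hv hu h.symm
    · exact (Near.refl G hv).mono (by simp))
  rw [Set.ncard_pair huv] at this
  push_cast at this
  omega

theorem bandwidth_le_of [Fintype V] (G : SimpleGraph V) (g : V → ℤ) (hg : Function.Injective g)
    (b : ℕ) (h : ∀ u v, G.Adj u v → |g u - g v| ≤ b) : bandwidth G ≤ b := by
  have h1 : bandwidth G ≤ bwOf G g := Nat.sInf_le ⟨g, hg, rfl⟩
  refine h1.trans (csSup_le' ?_)
  rintro n ⟨u, v, huv, rfl⟩
  have := h u v huv
  rw [Int.abs_eq_natAbs] at this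
  exact_mod_cast this


/-- Membership in the `m`-th clique. -/
def InQ (D : Dat V) (m : ℤ) (x : V) : Prop :=
  (D.K x = Kd.cut ∧ (D.ix x = m ∨ D.ix x = m + 1)) ∨ (D.K x = Kd.int ∧ D.ix x = m)

/-- Normal form of a block caterpillar. -/
structure NF (G : SimpleGraph V) (D : Dat V) : Prop where
  cut_uniq : ∀ x y, D.K x = Kd.cut → D.K y = Kd.cut → D.ix x = D.ix y → x = y
  int_cut : ∀ x, D.K x = Kd.int → (∃ c, D.K c = Kd.cut ∧ D.ix c = D.ix x) ∧
    (∃ c, D.K c = Kd.cut ∧ D.ix c = D.ix x + 1)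
  il_cut : ∀ x, D.K x = Kd.il → (∃ c, D.K c = Kd.cut ∧ D.ix c = D.ix x - 1) ∧
    (∃ c, D.K c = Kd.cut ∧ D.ix c = D.ix x + 2)
  cl_ow : ∀ x, D.K x = Kd.cl → D.K (D.ow x) = Kd.cut ∧ D.ix (D.ow x) = D.ix x ∧
    G.Adj x (D.ow x)
  il_ow : ∀ x, D.K x = Kd.il → D.K (D.ow x) = Kd.int ∧ D.ix (D.ow x) = D.ix x ∧
    G.Adj x (D.ow x)
  conv : ∀ c c', D.K c = Kd.cut → D.K c' = Kd.cut → ∀ t, D.ix c ≤ t → t ≤ D.ix c' →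
    ∃ d, D.K d = Kd.cut ∧ D.ix d = t
  clique : ∀ m x y, InQ D m x → InQ D m y → x ≠ y → G.Adj x y
  adj : ∀ x y, G.Adj x y → (∃ m, InQ D m x ∧ InQ D m y) ∨
    ((D.K x = Kd.cl ∨ D.K x = Kd.il) ∧ D.ow x = y) ∨
    ((D.K y = Kd.cl ∨ D.K y = Kd.il) ∧ D.ow y = x)

section NFsec
variable {G : SimpleGraph V} {D : Dat V}

theorem Dat.lo_cut {v : V} (h : D.K v = Kd.cut) : D.lo v = D.ix v := by simp [Dat.lo, h, loF]
theorem Dat.hi_cut {v : V} (h : D.K v = Kd.cut) : D.hi v = D.ix v := by simp [Dat.hi, h, hiF]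
theorem Dat.lo_int {v : V} (h : D.K v = Kd.int) : D.lo v = D.ix v := by simp [Dat.lo, h, loF]
theorem Dat.hi_int {v : V} (h : D.K v = Kd.int) : D.hi v = D.ix v + 1 := by
  simp [Dat.hi, h, hiF]
theorem Dat.lo_cl {v : V} (h : D.K v = Kd.cl) : D.lo v = D.ix v - 1 := by simp [Dat.lo, h, loF]
theorem Dat.hi_cl {v : V} (h : D.K v = Kd.cl) : D.hi v = D.ix v + 1 := by simp [Dat.hi, h, hiF]
theorem Dat.lo_il {v : V} (h : D.K v = Kd.il) : D.lo v = D.ix v - 1 := by simp [Dat.lo, h, loF]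
theorem Dat.hi_il {v : V} (h : D.K v = Kd.il) : D.hi v = D.ix v + 2 := by simp [Dat.hi, h, hiF]

/-- The set of vertices whose window lies in `[i, j]`. -/
def Win (D : Dat V) (i j : ℤ) : Set V := {v | i ≤ D.lo v ∧ D.hi v ≤ j}

theorem near_clique (h : NF G D) {S : Set V} {m : ℤ} {x y : V} (hx : x ∈ S) (hy : y ∈ S)
    (hxm : InQ D m x) (hym : InQ D m y) : Near G S x y 1 := by
  by_cases hxy : x = y
  · subst hxy; exact (Near.refl G hx).mono (by simp)
  · exact Near.adj hx hy (h.clique m x y hxm hym hxy)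

theorem cut_mem {i j : ℤ} {c : V} (hc : D.K c = Kd.cut) (h1 : i ≤ D.ix c) (h2 : D.ix c ≤ j) :
    c ∈ Win D i j := by
  constructor
  · rw [Dat.lo_cut hc]; exact h1
  · rw [Dat.hi_cut hc]; exact h2

theorem int_mem {i j : ℤ} {c : V} (hc : D.K c = Kd.int) (h1 : i ≤ D.ix c)
    (h2 : D.ix c + 1 ≤ j) : c ∈ Win D i j := by
  constructor
  · rw [Dat.lo_int hc]; exact h1
  · rw [Dat.hi_int hc]; exact h2

theorem near_cuts (h : NF G D) {i j : ℤ} (n : ℕ) : ∀ c c', D.K c = Kd.cut → D.K c' = Kd.cut →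
    D.ix c' = D.ix c + n → i ≤ D.ix c → D.ix c' ≤ j → Near G (Win D i j) c c' n := by
  induction n with
  | zero =>
    intro c c' hc hc' hn h1 h2
    have : c' = c := h.cut_uniq _ _ hc' hc (by simpa using hn)
    subst this
    exact Near.refl G (cut_mem hc h1 h2)
  | succ n ih =>
    intro c c' hc hc' hn h1 h2
    push_cast at hn
    obtain ⟨d, hd, hdt⟩ := h.conv c c' hc hc' (D.ix c + n) (by omega) (by omega)
    have h3 := ih c d hc hd hdt h1 (by omega)
    have h4 : Near G (Win D i j) d c' 1 :=
      near_clique h (m := D.ix d) (cut_mem hd (by omega) (by omega))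
        (cut_mem hc' (by omega) (by omega)) (Or.inl ⟨hd, Or.inl rfl⟩)
        (Or.inl ⟨hc', Or.inr (by omega)⟩)
    push_cast
    exact h3.trans h4

/-- right core -/
def cr (D : Dat V) (u : V) : ℤ :=
  match D.K u with
  | Kd.cut => D.ix u
  | Kd.cl => D.ix u
  | Kd.int => D.ix u + 1
  | Kd.il => D.ix u + 1

theorem near_right (h : NF G D) {i j : ℤ} {u : V} (hu : u ∈ Win D i j) :
    ∃ c, D.K c = Kd.cut ∧ D.ix c = cr D u ∧ i ≤ D.ix c ∧ D.ix c ≤ j ∧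
      Near G (Win D i j) u c (cr D u - D.lo u) := by
  obtain ⟨h1, h2⟩ := id hu
  rcases hk : D.K u with _ | _ | _ | _
  · rw [Dat.lo_cut hk] at h1 ⊢; rw [Dat.hi_cut hk] at h2
    simp only [cr, hk]
    exact ⟨u, hk, rfl, h1, h2, (Near.refl G hu).mono (by omega)⟩
  · rw [Dat.lo_int hk] at h1 ⊢; rw [Dat.hi_int hk] at h2
    simp only [cr, hk]
    obtain ⟨_, c, hc, hci⟩ := h.int_cut u hk
    exact ⟨c, hc, hci, by omega, by omega, (near_clique h (m := D.ix u) hu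
      (cut_mem hc (by omega) (by omega)) (Or.inr ⟨hk, rfl⟩) (Or.inl ⟨hc, Or.inr hci⟩)).mono
        (by omega)⟩
  · rw [Dat.lo_cl hk] at h1 ⊢; rw [Dat.hi_cl hk] at h2
    simp only [cr, hk]
    obtain ⟨hc, hci, ha⟩ := h.cl_ow u hk
    exact ⟨D.ow u, hc, hci, by omega, by omega, (Near.adj hu
      (cut_mem hc (by omega) (by omega)) ha).mono (by omega)⟩
  · rw [Dat.lo_il hk] at h1 ⊢; rw [Dat.hi_il hk] at h2
    simp only [cr, hk]
    obtain ⟨ho, hoi, ha⟩ := h.il_ow u hk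
    obtain ⟨_, c, hc, hci⟩ := h.int_cut _ ho
    have hom : D.ow u ∈ Win D i j := int_mem ho (by omega) (by omega)
    exact ⟨c, hc, by omega, by omega, by omega, ((Near.adj hu hom ha).trans
      (near_clique h (m := D.ix u) hom (cut_mem hc (by omega) (by omega)) (Or.inr ⟨ho, hoi⟩)
        (Or.inl ⟨hc, Or.inr (by omega)⟩))).mono (by omega)⟩

theorem near_left (h : NF G D) {i j : ℤ} {u : V} (hu : u ∈ Win D i j) :
    ∃ c, D.K c = Kd.cut ∧ D.ix c = D.ix u ∧ i ≤ D.ix c ∧ D.ix c ≤ j ∧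
      Near G (Win D i j) u c (D.hi u - D.ix u) := by
  obtain ⟨h1, h2⟩ := id hu
  rcases hk : D.K u with _ | _ | _ | _
  · rw [Dat.lo_cut hk] at h1; rw [Dat.hi_cut hk] at h2 ⊢
    exact ⟨u, hk, rfl, h1, h2, (Near.refl G hu).mono (by omega)⟩
  · rw [Dat.lo_int hk] at h1; rw [Dat.hi_int hk] at h2 ⊢
    obtain ⟨⟨c, hc, hci⟩, _⟩ := h.int_cut u hk
    exact ⟨c, hc, hci, by omega, by omega, (near_clique h (m := D.ix u) hu
      (cut_mem hc (by omega) (by omega)) (Or.inr ⟨hk, rfl⟩) (Or.inl ⟨hc, Or.inl hci⟩)).mono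
        (by omega)⟩
  · rw [Dat.lo_cl hk] at h1; rw [Dat.hi_cl hk] at h2 ⊢
    obtain ⟨hc, hci, ha⟩ := h.cl_ow u hk
    exact ⟨D.ow u, hc, hci, by omega, by omega, (Near.adj hu
      (cut_mem hc (by omega) (by omega)) ha).mono (by omega)⟩
  · rw [Dat.lo_il hk] at h1; rw [Dat.hi_il hk] at h2 ⊢
    obtain ⟨ho, hoi, ha⟩ := h.il_ow u hk
    obtain ⟨⟨c, hc, hci⟩, _⟩ := h.int_cut _ ho
    have hom : D.ow u ∈ Win D i j := int_mem ho (by omega) (by omega)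
    exact ⟨c, hc, by omega, by omega, by omega, ((Near.adj hu hom ha).trans
      (near_clique h (m := D.ix u) hom (cut_mem hc (by omega) (by omega)) (Or.inr ⟨ho, hoi⟩)
        (Or.inl ⟨hc, Or.inl (by omega)⟩))).mono (by omega)⟩

theorem near_ordered (h : NF G D) {i j : ℤ} {u v : V} (hu : u ∈ Win D i j) (hv : v ∈ Win D i j)
    (huv : cr D u ≤ D.ix v) : Near G (Win D i j) u v (j - i) := by
  obtain ⟨c, hc, hci, h1, h2, hn⟩ := near_right h hu
  obtain ⟨c', hc', hci', h1', h2', hn'⟩ := near_left h hv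
  have := near_cuts h (i := i) (j := j) (D.ix v - cr D u).toNat c c' hc hc' (by omega) h1 h2'
  refine ((hn.trans this).trans hn'.symm).mono ?_
  have := hu.1
  have := hv.2
  omega

/-- Interior vertices and their leaves: one step to the clique. -/
theorem near_win (h : NF G D) {i j : ℤ} (hij : i < j) {u v : V} (hu : u ∈ Win D i j)
    (hv : v ∈ Win D i j) : Near G (Win D i j) u v (j - i) := by
  by_cases h1 : cr D u ≤ D.ix v
  · exact near_ordered h hu hv h1
  by_cases h2 : cr D v ≤ D.ix u
  · exact (near_ordered h hv hu h2).symm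
  have key : ∀ w ∈ Win D i j, D.ix w < cr D w → ∃ x ∈ Win D i j, D.K x = Kd.int ∧
      D.ix x = D.ix w ∧ ((x = w) ∨ (Near G (Win D i j) w x 1 ∧ 3 ≤ j - i)) := by
    intro w hw hlt
    obtain ⟨h3, h4⟩ := id hw
    rcases hk : D.K w with _ | _ | _ | _
    · simp [cr, hk] at hlt
    · exact ⟨w, hw, hk, rfl, Or.inl rfl⟩
    · simp [cr, hk] at hlt
    · rw [Dat.lo_il hk] at h3; rw [Dat.hi_il hk] at h4
      obtain ⟨ho, hoi, ha⟩ := h.il_ow w hk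
      have hom : D.ow w ∈ Win D i j := int_mem ho (by omega) (by omega)
      exact ⟨D.ow w, hom, ho, hoi, Or.inr ⟨Near.adj hw hom ha, by omega⟩⟩
  have hcr : ∀ w, cr D w ≤ D.ix w + 1 := by
    intro w
    unfold cr
    split <;> omega
  have hu1 := hcr u
  have hv1 := hcr v
  obtain ⟨x, hx, hxk, hxi, hx'⟩ := key u hu (by omega)
  obtain ⟨y, hy, hyk, hyi, hy'⟩ := key v hv (by omega)
  have hxy : Near G (Win D i j) x y 1 := near_clique h (m := D.ix u) hx hy (Or.inr ⟨hxk, hxi⟩)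
    (Or.inr ⟨hyk, by omega⟩)
  rcases hx' with rfl | ⟨hx1, hx2⟩ <;> rcases hy' with rfl | ⟨hy1, hy2⟩
  · exact hxy.mono (by omega)
  · exact (hxy.trans hy1.symm).mono (by omega)
  · exact (hx1.trans hxy).mono (by omega)
  · exact ((hx1.trans hxy).trans hy1.symm).mono (by omega)

theorem NF.comb [Fintype V] (h : NF G D) (hb : 1 ≤ localDensity G) :
    Comb D (localDensity G : ℤ) where
  bpos := by exact_mod_cast hb
  cut_uniq := h.cut_uniq
  int_cut := h.int_cut
  il_cut := h.il_cut
  il_ow := fun x hx => ⟨(h.il_ow x hx).1, (h.il_ow x hx).2.1⟩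
  dens := by
    intro i j hij A hA
    have h1 := card_le_of_near G (Win D i j) (j - i) (by omega)
      (fun u hu v hv => near_win h hij hu hv)
    have h2 : A.card ≤ (Win D i j).ncard := by
      rw [← Set.ncard_coe_finset]
      exact Set.ncard_le_ncard (fun v hv => hA v hv) (Set.toFinite _)
    have h3 : (A.card : ℤ) ≤ (Win D i j).ncard := by exact_mod_cast h2
    omega
  star := by
    classical
    intro z hz A B hA hB
    obtain ⟨⟨c, hc, hci⟩, ⟨c', hc', hci'⟩⟩ := h.int_cut z hz
    set S : Set V := {v | InQ D (D.ix z) v ∨ (D.K v = Kd.il ∧ D.ow v = z)} with hS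
    have hzS : z ∈ S := Or.inl (Or.inr ⟨hz, rfl⟩)
    have hone : ∀ v ∈ S, Near G S v z 1 := by
      intro v hv
      rcases id hv with h1 | ⟨h1, h2⟩
      · exact near_clique h hv hzS h1 (Or.inr ⟨hz, rfl⟩)
      · have := (h.il_ow v h1).2.2
        rw [h2] at this
        exact Near.adj hv hzS this
    have h1 := card_le_of_near G S 2 (by omega)
      (fun u hu v hv => (hone u hu).trans (hone v hv).symm)
    have hcc : c ≠ c' := by rintro rfl; omega
    have hAB : Disjoint A B := by
      rw [Finset.disjoint_left]
      intro v h1 h2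
      have h3 := (hA v h1).1
      have h4 := (hB v h2).1
      rw [h3] at h4; cases h4
    have hcut : Disjoint (A ∪ B) {c, c'} := by
      rw [Finset.disjoint_right]
      intro v h1 h2
      have h3 : D.K v = Kd.cut := by
        rcases Finset.mem_insert.1 h1 with rfl | h1
        · exact hc
        · rw [Finset.mem_singleton.1 h1]; exact hc'
      rcases Finset.mem_union.1 h2 with h2 | h2
      · have h4 := (hA v h2).1
        rw [h3] at h4; cases h4
      · have h4 := (hB v h2).1
        rw [h3] at h4; cases h4
    have h2 : ((A ∪ B) ∪ {c, c'}).card ≤ S.ncard := by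
      rw [← Set.ncard_coe_finset]
      refine Set.ncard_le_ncard (fun v hv => ?_) (Set.toFinite _)
      rcases Finset.mem_union.1 hv with hv | hv
      · rcases Finset.mem_union.1 hv with hv | hv
        · exact Or.inl (Or.inr (hA v hv))
        · exact Or.inr (hB v hv)
      · rcases Finset.mem_insert.1 hv with rfl | hv
        · exact Or.inl (Or.inl ⟨hc, Or.inl hci⟩)
        · rw [Finset.mem_singleton.1 hv]; exact Or.inl (Or.inl ⟨hc', Or.inr hci'⟩)
    rw [Finset.card_union_of_disjoint hcut, Finset.card_union_of_disjoint hAB,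
      Finset.card_pair hcc] at h2
    have h3 : (A.card : ℤ) + B.card + 2 ≤ S.ncard := by exact_mod_cast h2
    omega

theorem NF.bandwidth_le [Fintype V] (h : NF G D) (hb : 1 ≤ localDensity G) :
    bandwidth G ≤ localDensity G := by
  obtain ⟨g, ⟨hinj, hw⟩, hil⟩ := exists_labeling (h.comb hb)
  set b : ℤ := (localDensity G : ℤ) with hbdef
  have hb0 : 0 ≤ b := by omega
  refine bandwidth_le_of G g hinj _ ?_
  have hQ : ∀ m x, InQ D m x → m * b ≤ g x ∧ g x ≤ (m + 1) * b := by
    intro m x hx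
    have h1 := hw x
    rcases hx with ⟨hk, hi⟩ | ⟨hk, hi⟩
    · rw [Dat.lo_cut hk, Dat.hi_cut hk] at h1
      rcases hi with hi | hi <;> rw [hi] at h1 <;> constructor <;> linarith [h1.1, h1.2]
    · rw [Dat.lo_int hk, Dat.hi_int hk, hi] at h1
      exact h1
  have hleaf : ∀ x, (D.K x = Kd.cl ∨ D.K x = Kd.il) → |g x - g (D.ow x)| ≤ b := by
    rintro x (hk | hk)
    · obtain ⟨h1, h2, _⟩ := h.cl_ow x hk
      have h3 := hw x
      have h4 := hw (D.ow x)
      rw [Dat.lo_cl hk, Dat.hi_cl hk] at h3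
      rw [Dat.lo_cut h1, Dat.hi_cut h1, h2] at h4
      rw [abs_le]
      constructor <;> linarith [h3.1, h3.2, h4.1, h4.2]
    · exact hil x hk
  intro u v huv
  rcases h.adj u v huv with ⟨m, h1, h2⟩ | ⟨h1, rfl⟩ | ⟨h1, rfl⟩
  · have h3 := hQ m u h1
    have h4 := hQ m v h2
    rw [abs_le]
    constructor <;> linarith [h3.1, h3.2, h4.1, h4.2]
  · exact hleaf u h1
  · rw [abs_sub_comm]; exact hleaf v h1

end NFsec

/-- A representation of the graph by a path of cliques `Q l, …, Q (r-1)` plus leaves. -/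
structure Rep (G : SimpleGraph V) (l r : ℤ) (Q : ℤ → V → Prop) : Prop where
  lt : l < r
  rng : ∀ m x, Q m x → l ≤ m ∧ m < r
  clique : ∀ m x y, Q m x → Q m y → x ≠ y → G.Adj x y
  share : ∀ m, l ≤ m → m + 1 < r → ∃ v, Q m v ∧ Q (m + 1) v
  sub : ∀ m x y, Q m x → Q (m + 1) x → Q m y → Q (m + 1) y → x = y
  disj : ∀ m n x, Q m x → Q n x → n ≤ m + 1
  leaf : ∀ v, (∀ m, ¬ Q m v) → ∃ x, (∃ m, Q m x) ∧ G.Adj v x ∧ ∀ y, G.Adj v y → y = x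
  edge : ∀ u v, G.Adj u v → (∃ i, Q i u) → (∃ j, Q j v) → ∃ m, Q m u ∧ Q m v

section RepSec
variable {G : SimpleGraph V} {l r : ℤ} {Q : ℤ → V → Prop}

theorem Rep.bound [Fintype V] (h : Rep G l r Q) : r - l ≤ Fintype.card V + 1 := by
  classical
  have h1 : ∀ m : Finset.Ico l (r - 1), ∃ v, Q m v ∧ Q (m + 1) v := fun m => by
    have := Finset.mem_Ico.1 m.2
    exact h.share m this.1 (by omega)
  choose f hf using h1
  have hinj : Function.Injective f := by
    intro m n hmn
    have h2 := hf m
    have h3 := hf n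
    rw [← hmn] at h3
    have h4 := h.disj _ _ _ h2.1 h3.2
    have h5 := h.disj _ _ _ h3.1 h2.2
    exact Subtype.ext (by omega)
  have h2 := Fintype.card_le_of_injective f hinj
  rw [Fintype.card_coe, Int.card_Ico] at h2
  omega

theorem Rep.reflect (h : Rep G l r Q) : Rep G (1 - r) (1 - l) (fun m x => Q (-m) x) where
  lt := by have := h.lt; omega
  rng := fun m x hx => by have := h.rng _ _ hx; omega
  clique := fun m x y => h.clique _ x y
  share := fun m h1 h2 => by
    obtain ⟨v, hv1, hv2⟩ := h.share (-(m + 1)) (by omega) (by omega)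
    refine ⟨v, ?_, hv1⟩
    rwa [show -(m + 1) + 1 = -m by omega] at hv2
  sub := fun m x y h1 h2 h3 h4 => by
    have e : -m = -(m + 1) + 1 := by omega
    rw [e] at h1 h3
    exact h.sub _ x y h2 h1 h4 h3
  disj := fun m n x h1 h2 => by have := h.disj _ _ _ h2 h1; omega
  leaf := fun v hv => by
    obtain ⟨x, ⟨m, hm⟩, h2⟩ := h.leaf v (fun m hm => hv (-m) (by simpa using hm))
    exact ⟨x, ⟨-m, by simpa using hm⟩, h2⟩
  edge := fun u v huv ⟨i, hi⟩ ⟨j, hj⟩ => by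
    obtain ⟨m, h1, h2⟩ := h.edge u v huv ⟨_, hi⟩ ⟨_, hj⟩
    exact ⟨-m, by simpa using h1, by simpa using h2⟩

/-- Maximal representation. -/
def MaxRep (G : SimpleGraph V) (l r : ℤ) (Q : ℤ → V → Prop) : Prop :=
  Rep G l r Q ∧ ∀ l' r' Q', Rep G l' r' Q' → r' - l' ≤ r - l

theorem MaxRep.reflect (h : MaxRep G l r Q) :
    MaxRep G (1 - r) (1 - l) (fun m x => Q (-m) x) :=
  ⟨h.1.reflect, fun l' r' Q' h' => by have := h.2 l' r' Q' h'; omega⟩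

theorem exists_maxRep [Fintype V] (h : Rep G l r Q) : ∃ l r Q, MaxRep G l r Q := by
  set S : Set ℕ := {n | ∃ l r Q, Rep G l r Q ∧ r - l = n} with hS
  have hne : S.Nonempty := ⟨(r - l).toNat, l, r, Q, h, by have := h.lt; omega⟩
  have hbdd : BddAbove S := by
    refine ⟨Fintype.card V + 1, ?_⟩
    rintro n ⟨l, r, Q, h, hn⟩
    have := h.bound
    omega
  obtain ⟨l, r, Q, h, hn⟩ := Nat.sSup_mem hne hbdd
  refine ⟨l, r, Q, h, fun l' r' Q' h' => ?_⟩
  have : (r' - l').toNat ≤ sSup S := le_csSup hbdd ⟨l', r', Q', h', by have := h'.lt; omega⟩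
  omega

theorem MaxRep.left (h : MaxRep G l r Q) {x : V} (hx : Q l x) : Q (l + 1) x := by
  by_contra hx1
  have hr := h.1
  have hlt := hr.lt
  have hx2 : ∀ m, Q m x → m = l := by
    intro m hm
    have h1 := hr.disj _ _ _ hx hm
    have h2 := (hr.rng _ _ hm).1
    have h3 : m ≠ l + 1 := fun e => hx1 (e ▸ hm)
    omega
  have hrep : Rep G (l - 1) r (fun m y => (m = l - 1 ∧ y = x) ∨ Q m y) := by
    constructor
    · omega
    · rintro m y (⟨rfl, rfl⟩ | hy)
      · omega
      · have := hr.rng _ _ hy; omega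
    · rintro m y z (⟨rfl, rfl⟩ | hy) (⟨h1, rfl⟩ | hz) hyz
      · exact absurd rfl hyz
      · have := hr.rng _ _ hz; omega
      · have := hr.rng _ _ hy; omega
      · exact hr.clique m y z hy hz hyz
    · intro m h1 h2
      by_cases hm : m = l - 1
      · exact ⟨x, Or.inl ⟨hm, rfl⟩, Or.inr (by rw [hm, sub_add_cancel]; exact hx)⟩
      · obtain ⟨v, hv⟩ := hr.share m (by omega) h2
        exact ⟨v, Or.inr hv.1, Or.inr hv.2⟩
    · rintro m y z (⟨h1, rfl⟩ | h1) (⟨h2, h2'⟩ | h2) (⟨h3, rfl⟩ | h3) (⟨h4, h4'⟩ | h4) <;>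
        first
        | omega
        | rfl
        | (have := hr.rng _ _ h1; omega)
        | (have := hr.rng _ _ h3; omega)
        | (have := hr.rng _ _ h2; omega)
        | (have := hr.rng _ _ h4; omega)
        | exact hr.sub m y z h1 h2 h3 h4
    · rintro m n y (⟨rfl, rfl⟩ | h1) (⟨rfl, h2'⟩ | h2)
      · omega
      · have := hx2 _ h2; omega
      · have := hr.rng _ _ h1; omega
      · exact hr.disj _ _ _ h1 h2
    · intro v hv
      obtain ⟨y, ⟨m, hm⟩, h2⟩ := hr.leaf v (fun m hm => hv m (Or.inr hm))
      exact ⟨y, ⟨m, Or.inr hm⟩, h2⟩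
    · intro u v huv hu hv
      have key : ∀ w, (∃ i, (i = l - 1 ∧ w = x) ∨ Q i w) → ∃ i, Q i w := by
        rintro w ⟨i, ⟨_, rfl⟩ | hi⟩
        · exact ⟨l, hx⟩
        · exact ⟨i, hi⟩
      obtain ⟨m, h1, h2⟩ := hr.edge u v huv (key u hu) (key v hv)
      exact ⟨m, Or.inr h1, Or.inr h2⟩
  have := h.2 _ _ _ hrep
  omega

theorem MaxRep.left2 (h : MaxRep G l r Q) {y v : V} (hy : Q (l + 1) y) (hy0 : ¬ Q l y)
    (hy2 : ¬ Q (l + 2) y) (hv : ∀ m, ¬ Q m v) (hvy : G.Adj v y) : False := by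
  have hr := h.1
  have hlt := hr.rng _ _ hy
  have hyo : ∀ m, Q m y → m = l + 1 := by
    intro m hm
    have h1 := hr.disj _ _ _ hy hm
    have h2 := hr.disj _ _ _ hm hy
    have h3 : m ≠ l := fun e => hy0 (e ▸ hm)
    have h4 : m ≠ l + 2 := fun e => hy2 (e ▸ hm)
    omega
  have hvl : ∀ z, G.Adj v z → z = y := by
    obtain ⟨x, _, _, h3⟩ := hr.leaf v hv
    intro z hz
    rw [h3 z hz, h3 y hvy]
  have hvy' : v ≠ y := hvy.ne
  set Q' : ℤ → V → Prop := fun m x => (m = l - 1 ∧ x = v) ∨ (m = l ∧ (x = v ∨ x = y)) ∨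
    (l < m ∧ Q m x) with hQ'
  have hold : ∀ w m, Q m w → ∃ n, l < n ∧ Q n w := by
    intro w m hm
    by_cases e : m = l
    · exact ⟨l + 1, by omega, h.left (e ▸ hm)⟩
    · have := hr.rng _ _ hm
      exact ⟨m, by omega, hm⟩
  have hrep : Rep G (l - 1) r Q' := by
    constructor
    · omega
    · rintro m x (⟨rfl, rfl⟩ | ⟨rfl, _⟩ | ⟨h1, h2⟩)
      · omega
      · omega
      · have := hr.rng _ _ h2; omega
    · rintro m x z (⟨rfl, rfl⟩ | ⟨rfl, h1⟩ | ⟨h1, h2⟩) (⟨h3, rfl⟩ | ⟨h3, h4⟩ | ⟨h3, h4⟩) hxz <;>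
        try omega
      · exact absurd rfl hxz
      · rcases h1 with rfl | rfl <;> rcases h4 with rfl | rfl
        · exact absurd rfl hxz
        · exact hvy
        · exact hvy.symm
        · exact absurd rfl hxz
      · exact hr.clique m x z h2 h4 hxz
    · intro m h1 h2
      by_cases hm : m = l - 1
      · exact ⟨v, Or.inl ⟨hm, rfl⟩, Or.inr (Or.inl ⟨by omega, Or.inl rfl⟩)⟩
      by_cases hm' : m = l
      · exact ⟨y, Or.inr (Or.inl ⟨hm', Or.inr rfl⟩), Or.inr (Or.inr ⟨by omega, hm' ▸ hy⟩)⟩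
      · obtain ⟨v, hv⟩ := hr.share m (by omega) h2
        exact ⟨v, Or.inr (Or.inr ⟨by omega, hv.1⟩), Or.inr (Or.inr ⟨by omega, hv.2⟩)⟩
    · have key : ∀ m x, Q' m x → Q' (m + 1) x →
          (m = l - 1 ∧ x = v) ∨ (m = l ∧ x = y) ∨ (Q m x ∧ Q (m + 1) x) := by
        rintro m x (⟨rfl, rfl⟩ | ⟨rfl, h1⟩ | ⟨h1, h2⟩) (⟨h3, h4⟩ | ⟨h3, h4⟩ | ⟨h3, h4⟩) <;>
          try omega
        · exact Or.inl ⟨rfl, rfl⟩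
        · rcases h1 with rfl | rfl
          · exact absurd h4 (hv _)
          · exact Or.inr (Or.inl ⟨rfl, rfl⟩)
        · exact Or.inr (Or.inr ⟨h2, h4⟩)
      have key2 : ∀ m x, Q' m x → Q' (m + 1) x →
          (m = l - 1 ∧ x = v) ∨ (m = l ∧ x = y) ∨ (l < m ∧ Q m x ∧ Q (m + 1) x) := by
        intro m x h1 h2
        rcases key m x h1 h2 with h3 | h3 | h3
        · exact Or.inl h3
        · exact Or.inr (Or.inl h3)
        · rcases h1 with ⟨_, rfl⟩ | ⟨h4, rfl | h5⟩ | ⟨h4, _⟩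
          · exact absurd h3.1 (hv _)
          · exact absurd h3.1 (hv _)
          · exact Or.inr (Or.inl ⟨h4, h5⟩)
          · exact Or.inr (Or.inr ⟨h4, h3⟩)
      intro m x z h1 h2 h3 h4
      rcases key2 m x h1 h2 with ⟨h5, h6⟩ | ⟨h5, h6⟩ | ⟨h5, h6, h7⟩ <;>
        rcases key2 m z h3 h4 with ⟨h8, h9⟩ | ⟨h8, h9⟩ | ⟨h8, h9, h10⟩ <;> try omega
      · rw [h6, h9]
      · rw [h6, h9]
      · exact hr.sub m x z h6 h7 h9 h10
    · rintro m n x (⟨rfl, rfl⟩ | ⟨rfl, h1⟩ | ⟨h1, h2⟩) (⟨h3, h4⟩ | ⟨h3, h4⟩ | ⟨h3, h4⟩) <;>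
        try omega
      · exact absurd h4 (hv _)
      · rcases h1 with rfl | rfl
        · exact absurd h4 (hv _)
        · have := hyo _ h4; omega
      · exact hr.disj _ _ _ h2 h4
    · intro w hw
      obtain ⟨x, ⟨m, hm⟩, h2⟩ := hr.leaf w (fun m hm => by
        obtain ⟨n, hn⟩ := hold w m hm
        exact hw n (Or.inr (Or.inr hn)))
      obtain ⟨n, hn⟩ := hold x m hm
      exact ⟨x, ⟨n, Or.inr (Or.inr hn)⟩, h2⟩
    · intro u w huw hu hw
      have key : ∀ w, (∃ i, Q' i w) → w = v ∨ ∃ i, Q i w := by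
        rintro w ⟨i, ⟨_, rfl⟩ | ⟨_, rfl | rfl⟩ | ⟨_, hi⟩⟩
        · exact Or.inl rfl
        · exact Or.inl rfl
        · exact Or.inr ⟨_, hy⟩
        · exact Or.inr ⟨i, hi⟩
      rcases key u hu with hu' | hu' 
      · subst hu'
        have := hvl _ huw
        subst this
        exact ⟨l, Or.inr (Or.inl ⟨rfl, Or.inl rfl⟩), Or.inr (Or.inl ⟨rfl, Or.inr rfl⟩)⟩
      rcases key w hw with hw' | hw'
      · subst hw'
        have := hvl _ huw.symm
        subst this
        exact ⟨l, Or.inr (Or.inl ⟨rfl, Or.inr rfl⟩), Or.inr (Or.inl ⟨rfl, Or.inl rfl⟩)⟩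
      obtain ⟨m, h1, h2⟩ := hr.edge u w huw hu' hw'
      by_cases e : m = l
      · subst e
        exact ⟨m + 1, Or.inr (Or.inr ⟨by omega, h.left h1⟩),
          Or.inr (Or.inr ⟨by omega, h.left h2⟩)⟩
      · have := hr.rng _ _ h1
        exact ⟨m, Or.inr (Or.inr ⟨by omega, h1⟩), Or.inr (Or.inr ⟨by omega, h2⟩)⟩
  have := h.2 _ _ _ hrep
  omega

theorem MaxRep.right (h : MaxRep G l r Q) {x : V} (hx : Q (r - 1) x) : Q (r - 2) x := by
  have := h.reflect.left (x := x) (by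
    change Q (-(1 - r)) x
    rwa [show -(1 - r) = r - 1 by omega])
  change Q (-(1 - r + 1)) x at this
  rwa [show -(1 - r + 1) = r - 2 by omega] at this

theorem MaxRep.right2 (h : MaxRep G l r Q) {y v : V} (hy : Q (r - 2) y) (hy0 : ¬ Q (r - 1) y)
    (hy2 : ¬ Q (r - 3) y) (hv : ∀ m, ¬ Q m v) (hvy : G.Adj v y) : False := by
  refine h.reflect.left2 (y := y) (v := v) ?_ ?_ ?_ (fun m => hv _) hvy
  · change Q (-(1 - r + 1)) y
    rwa [show -(1 - r + 1) = r - 2 by omega]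
  · change ¬ Q (-(1 - r)) y
    rwa [show -(1 - r) = r - 1 by omega]
  · change ¬ Q (-(1 - r + 2)) y
    rwa [show -(1 - r + 2) = r - 3 by omega]

theorem MaxRep.exists_NF (h : MaxRep G l r Q) : ∃ D : Dat V, NF G D := by
  classical
  have hr := h.1
  have hspec : ∀ v : V, ∃ p : Kd × ℤ × V,
      (p.1 = Kd.cut ∧ Q (p.2.1 - 1) v ∧ Q p.2.1 v) ∨
      (p.1 = Kd.int ∧ Q p.2.1 v ∧ ¬ Q (p.2.1 - 1) v ∧ ¬ Q (p.2.1 + 1) v) ∨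
      (p.1 = Kd.cl ∧ (∀ m, ¬ Q m v) ∧ Q (p.2.1 - 1) p.2.2 ∧ Q p.2.1 p.2.2 ∧ G.Adj v p.2.2) ∨
      (p.1 = Kd.il ∧ (∀ m, ¬ Q m v) ∧ Q p.2.1 p.2.2 ∧ ¬ Q (p.2.1 - 1) p.2.2 ∧
        ¬ Q (p.2.1 + 1) p.2.2 ∧ G.Adj v p.2.2) := by
    intro v
    have key : ∀ w m, Q m w → (∃ n, Q (n - 1) w ∧ Q n w) ∨
        (Q m w ∧ ¬ Q (m - 1) w ∧ ¬ Q (m + 1) w) := by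
      intro w m hm
      by_cases h1 : Q (m - 1) w
      · exact Or.inl ⟨m, h1, hm⟩
      by_cases h2 : Q (m + 1) w
      · exact Or.inl ⟨m + 1, by rwa [add_sub_cancel_right], h2⟩
      · exact Or.inr ⟨hm, h1, h2⟩
    by_cases hv : ∃ m, Q m v
    · obtain ⟨m, hm⟩ := hv
      rcases key v m hm with ⟨n, hn⟩ | h1
      · exact ⟨(Kd.cut, n, v), Or.inl ⟨rfl, hn⟩⟩
      · exact ⟨(Kd.int, m, v), Or.inr (Or.inl ⟨rfl, h1⟩)⟩
    · have hv' : ∀ m, ¬ Q m v := fun m hm => hv ⟨m, hm⟩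
      obtain ⟨x, ⟨m, hm⟩, hx, _⟩ := hr.leaf v hv'
      rcases key x m hm with ⟨n, hn⟩ | h1
      · exact ⟨(Kd.cl, n, x), Or.inr (Or.inr (Or.inl ⟨rfl, hv', hn.1, hn.2, hx⟩))⟩
      · exact ⟨(Kd.il, m, x), Or.inr (Or.inr (Or.inr ⟨rfl, hv', h1.1, h1.2.1, h1.2.2, hx⟩))⟩
  choose p hp using hspec
  set D : Dat V := ⟨fun v => (p v).1, fun v => (p v).2.1, fun v => (p v).2.2⟩ with hD
  have hp' : ∀ v, (D.K v = Kd.cut ∧ Q (D.ix v - 1) v ∧ Q (D.ix v) v) ∨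
      (D.K v = Kd.int ∧ Q (D.ix v) v ∧ ¬ Q (D.ix v - 1) v ∧ ¬ Q (D.ix v + 1) v) ∨
      (D.K v = Kd.cl ∧ (∀ m, ¬ Q m v) ∧ Q (D.ix v - 1) (D.ow v) ∧ Q (D.ix v) (D.ow v) ∧
        G.Adj v (D.ow v)) ∨
      (D.K v = Kd.il ∧ (∀ m, ¬ Q m v) ∧ Q (D.ix v) (D.ow v) ∧ ¬ Q (D.ix v - 1) (D.ow v) ∧
        ¬ Q (D.ix v + 1) (D.ow v) ∧ G.Adj v (D.ow v)) := hp
  clear_value D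
  clear hp
  have scut : ∀ v, D.K v = Kd.cut → Q (D.ix v - 1) v ∧ Q (D.ix v) v := by
    intro v hv
    rcases hp' v with h1 | h1 | h1 | h1 <;> first | exact h1.2 | (rw [hv] at h1; cases h1.1)
  have sint : ∀ v, D.K v = Kd.int →
      Q (D.ix v) v ∧ ¬ Q (D.ix v - 1) v ∧ ¬ Q (D.ix v + 1) v := by
    intro v hv
    rcases hp' v with h1 | h1 | h1 | h1 <;> first | exact h1.2 | (rw [hv] at h1; cases h1.1)
  have scl : ∀ v, D.K v = Kd.cl → (∀ m, ¬ Q m v) ∧ Q (D.ix v - 1) (D.ow v) ∧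
      Q (D.ix v) (D.ow v) ∧ G.Adj v (D.ow v) := by
    intro v hv
    rcases hp' v with h1 | h1 | h1 | h1 <;> first | exact h1.2 | (rw [hv] at h1; cases h1.1)
  have sil : ∀ v, D.K v = Kd.il → (∀ m, ¬ Q m v) ∧ Q (D.ix v) (D.ow v) ∧
      ¬ Q (D.ix v - 1) (D.ow v) ∧ ¬ Q (D.ix v + 1) (D.ow v) ∧ G.Adj v (D.ow v) := by
    intro v hv
    rcases hp' v with h1 | h1 | h1 | h1 <;> first | exact h1.2 | (rw [hv] at h1; cases h1.1)
  have tcut : ∀ v m, Q (m - 1) v → Q m v → D.K v = Kd.cut ∧ D.ix v = m := by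
    intro v m h1 h2
    rcases hp' v with ⟨h3, h4, h5⟩ | ⟨h3, h4, h5, h6⟩ | ⟨h3, h4, _⟩ | ⟨h3, h4, _⟩
    · have a := hr.disj _ _ _ h1 h5
      have b := hr.disj _ _ _ h4 h2
      exact ⟨h3, by omega⟩
    · exfalso
      have a := hr.disj _ _ _ h1 h4
      have b := hr.disj _ _ _ h4 h2
      have c : D.ix v = m ∨ D.ix v = m - 1 := by omega
      rcases c with c | c
      · rw [c] at h5; exact h5 h1
      · rw [c, sub_add_cancel] at h6; exact h6 h2
    · exact absurd h2 (h4 _)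
    · exact absurd h2 (h4 _)
  have tint : ∀ v m, Q m v → ¬ Q (m - 1) v → ¬ Q (m + 1) v → D.K v = Kd.int ∧ D.ix v = m := by
    intro v m h1 h2 h2'
    have only : ∀ n, Q n v → n = m := by
      intro n hn
      have a := hr.disj _ _ _ h1 hn
      have b := hr.disj _ _ _ hn h1
      have c : n ≠ m - 1 := fun e => h2 (e ▸ hn)
      have d : n ≠ m + 1 := fun e => h2' (e ▸ hn)
      omega
    rcases hp' v with ⟨h3, h4, h5⟩ | ⟨h3, h4, h5, h6⟩ | ⟨h3, h4, _⟩ | ⟨h3, h4, _⟩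
    · have a := only _ h4
      have b := only _ h5
      omega
    · exact ⟨h3, only _ h4⟩
    · exact absurd h1 (h4 _)
    · exact absurd h1 (h4 _)
  have cutex : ∀ m, l < m → m < r → ∃ c, D.K c = Kd.cut ∧ D.ix c = m := by
    intro m h1 h2
    obtain ⟨v, hv1, hv2⟩ := hr.share (m - 1) (by omega) (by omega)
    rw [sub_add_cancel] at hv2
    exact ⟨v, tcut v m hv1 hv2⟩
  have inq : ∀ m x, InQ D m x ↔ Q m x := by
    intro m x
    constructor
    · rintro (⟨hk, h1 | h1⟩ | ⟨hk, h1⟩)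
      · exact h1 ▸ (scut x hk).2
      · have := (scut x hk).1
        rwa [h1, add_sub_cancel_right] at this
      · exact h1 ▸ (sint x hk).1
    · intro hx
      by_cases h1 : Q (m - 1) x
      · have := tcut x m h1 hx
        exact Or.inl ⟨this.1, Or.inl this.2⟩
      by_cases h2 : Q (m + 1) x
      · have := tcut x (m + 1) (by rwa [add_sub_cancel_right]) h2
        exact Or.inl ⟨this.1, Or.inr this.2⟩
      · exact Or.inr (tint x m hx h1 h2)
  have intrng : ∀ x m, Q m x → ¬ Q (m - 1) x → ¬ Q (m + 1) x → l < m ∧ m + 1 < r := by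
    intro x m h1 h2 h3
    have a := hr.rng _ _ h1
    have b : m ≠ l := by
      rintro rfl
      exact h3 (h.left h1)
    have c : m ≠ r - 1 := by
      rintro rfl
      have := h.right h1
      rw [show r - 1 - 1 = r - 2 by omega] at h2
      exact h2 this
    omega
  refine ⟨D, ?_, ?_, ?_, ?_, ?_, ?_, ?_, ?_⟩
  · intro x y hx hy hxy
    have h1 := scut x hx
    have h2 := scut y hy
    rw [← hxy] at h2
    exact hr.sub (D.ix x - 1) x y h1.1 (by rw [sub_add_cancel]; exact h1.2) h2.1
      (by rw [sub_add_cancel]; exact h2.2)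
  · intro x hx
    obtain ⟨h1, h2, h3⟩ := sint x hx
    have := intrng x _ h1 h2 h3
    exact ⟨cutex _ (by omega) (by omega), cutex _ (by omega) (by omega)⟩
  · intro x hx
    obtain ⟨h0, h1, h2, h3, h4⟩ := sil x hx
    have := intrng _ _ h1 h2 h3
    have a : D.ix x ≠ l + 1 := by
      intro e
      rw [e] at h1 h2 h3
      rw [add_sub_cancel_right] at h2
      rw [show l + 1 + 1 = l + 2 by omega] at h3
      exact h.left2 h1 h2 h3 h0 h4
    have b : D.ix x ≠ r - 2 := by
      intro e
      rw [e] at h1 h2 h3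
      rw [show r - 2 - 1 = r - 3 by omega] at h2
      rw [show r - 2 + 1 = r - 1 by omega] at h3
      exact h.right2 h1 h3 h2 h0 h4
    exact ⟨cutex _ (by omega) (by omega), cutex _ (by omega) (by omega)⟩
  · intro x hx
    obtain ⟨_, h1, h2, h3⟩ := scl x hx
    have := tcut _ _ h1 h2
    exact ⟨this.1, this.2, h3⟩
  · intro x hx
    obtain ⟨_, h1, h2, h3, h4⟩ := sil x hx
    have := tint _ _ h1 h2 h3
    exact ⟨this.1, this.2, h4⟩
  · intro c c' hc hc' t h1 h2
    have a := hr.rng _ _ (scut c hc).1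
    have b := hr.rng _ _ (scut c' hc').2
    exact cutex t (by omega) (by omega)
  · intro m x y hx hy
    exact hr.clique m x y ((inq m x).1 hx) ((inq m y).1 hy)
  · intro x y hxy
    have key : ∀ x y, G.Adj x y → (∀ m, ¬ Q m x) →
        (D.K x = Kd.cl ∨ D.K x = Kd.il) ∧ D.ow x = y := by
      intro x y hxy hx
      obtain ⟨z, _, _, hz⟩ := hr.leaf x hx
      rcases hp' x with ⟨_, h4, _⟩ | ⟨_, h4, _⟩ | ⟨h3, _, _, _, h4⟩ | ⟨h3, _, _, _, _, h4⟩
      · exact absurd h4 (hx _)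
      · exact absurd h4 (hx _)
      · exact ⟨Or.inl h3, by rw [hz _ h4, hz _ hxy]⟩
      · exact ⟨Or.inr h3, by rw [hz _ h4, hz _ hxy]⟩
    by_cases hx : ∃ m, Q m x
    · by_cases hy : ∃ m, Q m y
      · obtain ⟨m, h1, h2⟩ := hr.edge x y hxy hx hy
        exact Or.inl ⟨m, (inq m x).2 h1, (inq m y).2 h2⟩
      · exact Or.inr (Or.inr (key y x hxy.symm (fun m hm => hy ⟨m, hm⟩)))
    · exact Or.inr (Or.inl (key x y hxy (fun m hm => hx ⟨m, hm⟩)))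

end RepSec

theorem rep_of_blockCaterpillar (G : SimpleGraph V) (hG : IsBlockCaterpillar G) :
    ∃ l r Q, Rep G l r Q := by
  obtain ⟨k, Q, hk, hcl, hsh, hdj, hlf, hed⟩ := hG
  set P : ℤ → V → Prop := fun m x => ∃ i : Fin k, ((i : ℕ) : ℤ) = m ∧ x ∈ Q i with hP
  have hU : ∀ v, v ∈ (⋃ i, Q i) ↔ ∃ m, P m v := by
    intro v
    rw [Set.mem_iUnion]
    constructor
    · rintro ⟨i, hi⟩; exact ⟨_, i, rfl, hi⟩
    · rintro ⟨_, i, _, hi⟩; exact ⟨i, hi⟩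
  refine ⟨0, k, P, ?_, ?_, ?_, ?_, ?_, ?_, ?_, ?_⟩
  · exact_mod_cast hk
  · rintro m x ⟨i, rfl, _⟩
    have := i.2
    omega
  · rintro m x y ⟨i, hi, hx⟩ ⟨j, hj, hy⟩ hxy
    have : i = j := Fin.ext (by omega)
    subst this
    exact hcl i x hx y hy hxy
  · intro m h1 h2
    obtain ⟨n, rfl⟩ : ∃ n : ℕ, m = n := ⟨m.toNat, by omega⟩
    obtain ⟨v, hv⟩ := hsh ⟨n, by omega⟩ ⟨n + 1, by omega⟩ rfl
    have : v ∈ Q ⟨n, by omega⟩ ∩ Q ⟨n + 1, by omega⟩ := by rw [hv]; rfl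
    exact ⟨v, ⟨_, rfl, this.1⟩, ⟨_, by push_cast; rfl, this.2⟩⟩
  · rintro m x y ⟨i, hi, h1⟩ ⟨j, hj, h2⟩ ⟨i', hi', h3⟩ ⟨j', hj', h4⟩
    have e1 : i' = i := Fin.ext (by omega)
    have e2 : j' = j := Fin.ext (by omega)
    subst e1 e2
    obtain ⟨v, hv⟩ := hsh i' j' (by omega)
    have a : x ∈ Q i' ∩ Q j' := ⟨h1, h2⟩
    have b : y ∈ Q i' ∩ Q j' := ⟨h3, h4⟩
    rw [hv] at a b
    rw [Set.mem_singleton_iff] at a b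
    rw [a, b]
  · rintro m n x ⟨i, rfl, h1⟩ ⟨j, rfl, h2⟩
    by_contra hlt
    have a : x ∈ Q i ∩ Q j := ⟨h1, h2⟩
    rw [hdj i j (by omega)] at a
    exact a
  · intro v hv
    obtain ⟨⟨x, hx, hx'⟩, h2⟩ := hlf v (fun h => by
      obtain ⟨m, hm⟩ := (hU v).1 h
      exact hv m hm)
    exact ⟨x, (hU x).1 (h2 x hx), hx, hx'⟩
  · intro u v huv hu hv
    obtain ⟨i, h1, h2⟩ := hed u v huv ((hU u).2 hu) ((hU v).2 hv)
    exact ⟨_, ⟨i, rfl, h1⟩, ⟨i, rfl, h2⟩⟩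

theorem main [Fintype V] (G : SimpleGraph V) (hG : IsBlockCaterpillar G) :
    bandwidth G = localDensity G := by
  refine le_antisymm ?_ (localDensity_le G)
  by_cases he : ∃ u v, G.Adj u v
  · obtain ⟨u, v, huv⟩ := he
    obtain ⟨l, r, Q, h⟩ := rep_of_blockCaterpillar G hG
    obtain ⟨l, r, Q, h⟩ := exists_maxRep h
    obtain ⟨D, hD⟩ := h.exists_NF
    exact hD.bandwidth_le (one_le_localDensity G huv)
  · obtain ⟨f, hf, _⟩ := bandwidth_attained G
    exact bandwidth_le_of G f hf _ (fun u v huv => absurd ⟨u, v, huv⟩ he)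

end Graph
end BC

/-- For every block caterpillar, the bandwidth equals the local density. -/
theorem blockCaterpillar_bandwidth_eq_localDensity {V : Type*} [Fintype V]
    (G : SimpleGraph V) (hG : IsBlockCaterpillar G) :
    bandwidth G = localDensity G := by
  exact BC.main G hG
end

section
/- Let b ≥ 4 be an even integer and let f be a bijection from the vertex set of R_b' onto {0, 1, …, 4b} with bandwidth B(f) = b (an optimal numbering). Then either f(v) < b for every vertex v ∈ X ∪ Z, or f(v) > 3b for every vertex v ∈ X ∪ Z. -/
/-- Underlying asymmetric relation for `R'graph b`.
Spine vertices (`Fin 4`): `0 = x`, `1 = y`, `2 = z`, `3 = w`, with `w` adjacent to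
`x, y, z`.  Tagged vertices `(t, _) : Fin 2 × Fin (b/2)`: `t = 0` is the leaf set `X`
attached to `x` and `t = 1` the leaf set `Z` attached to `z`.  `Fin b` is the leaf set
`Y` attached to `y`, and `Fin (2b - 3)` is the leaf set `W` attached to `w`. -/
def R'Rel (b : ℕ) : Fin 4 ⊕ ((Fin 2 × Fin (b / 2)) ⊕ (Fin b ⊕ Fin (2 * b - 3))) →
    Fin 4 ⊕ ((Fin 2 × Fin (b / 2)) ⊕ (Fin b ⊕ Fin (2 * b - 3))) → Prop
  | Sum.inl i, Sum.inl j => i = 3 ∧ j ≠ 3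
  | Sum.inl i, Sum.inr (Sum.inl (t, _)) => (t = 0 ∧ i = 0) ∨ (t = 1 ∧ i = 2)
  | Sum.inl i, Sum.inr (Sum.inr (Sum.inl _)) => i = 1
  | Sum.inl i, Sum.inr (Sum.inr (Sum.inr _)) => i = 3
  | _, _ => False

/-- The near-caterpillar tree `R_b'` on `4b + 1` vertices. -/
def R'graph (b : ℕ) : SimpleGraph (Fin 4 ⊕ ((Fin 2 × Fin (b / 2)) ⊕ (Fin b ⊕ Fin (2 * b - 3)))) :=
  SimpleGraph.fromRel (R'Rel b)

theorem R'graph_edge_bound (b : ℕ) 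
    (f : Fin 4 ⊕ ((Fin 2 × Fin (b / 2)) ⊕ (Fin b ⊕ Fin (2 * b - 3))) → ℤ)
    (hmem : ∀ v, 0 ≤ f v ∧ f v ≤ 4 * b)
    (hbw : bwOf (R'graph b) f = b) (u v) (h : R'Rel b u v) (hne : u ≠ v) :
    |f u - f v| ≤ b := by
  have h1 : (f u - f v).natAbs ≤ bwOf (R'graph b) f := by
    apply le_csSup
    · refine ⟨4 * b, ?_⟩
      rintro n ⟨s, t, -, rfl⟩
      have := hmem s
      have := hmem t
      omega
    · exact ⟨u, v, (SimpleGraph.fromRel_adj _ _ _).2 ⟨hne, Or.inl h⟩, rfl⟩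
  rw [hbw] at h1
  rw [abs_le]
  omega

/-- In every optimal numbering of `R_b'` (`b ≥ 4` even) with positions `{0, …, 4b}`,
the vertices of `X ∪ Z` are all below `b` or all above `3b`. -/
theorem R'graph_XZ_positions (b : ℕ) (hb : 4 ≤ b) (heven : Even b)
    (f : Fin 4 ⊕ ((Fin 2 × Fin (b / 2)) ⊕ (Fin b ⊕ Fin (2 * b - 3))) → ℤ)
    (hbij : Set.BijOn f Set.univ (Set.Icc (0 : ℤ) (4 * b)))
    (hbw : bwOf (R'graph b) f = b) :
    (∀ v : Fin 2 × Fin (b / 2), f (Sum.inr (Sum.inl v)) < (b : ℤ)) ∨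
    (∀ v : Fin 2 × Fin (b / 2), (3 * b : ℤ) < f (Sum.inr (Sum.inl v))) := by
  have hmem : ∀ v, 0 ≤ f v ∧ f v ≤ 4 * b := fun v => hbij.mapsTo (Set.mem_univ v)
  have hinj : Function.Injective f := Set.injOn_univ.1 hbij.injOn
  have hE := R'graph_edge_bound b f hmem hbw
  have hS : ∀ i : Fin 4, |f (Sum.inl 3) - f (Sum.inl i)| ≤ b := by
    intro i
    by_cases hi : i = 3
    · subst hi; simp
    · exact hE _ _ ⟨rfl, hi⟩ (by simpa using fun h => hi h.symm)
  have hW : ∀ i, |f (Sum.inl 3) - f (Sum.inr (Sum.inr (Sum.inr i)))| ≤ b :=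
    fun i => hE _ _ rfl (by simp)
  have hY : ∀ i, |f (Sum.inl 1) - f (Sum.inr (Sum.inr (Sum.inl i)))| ≤ b :=
    fun i => hE _ _ rfl (by simp)
  have hX : ∀ v, ∃ j, |f (Sum.inl j) - f (Sum.inr (Sum.inl v))| ≤ b := by
    rintro ⟨t, i⟩
    fin_cases t
    · exact ⟨0, hE _ _ (Or.inl ⟨rfl, rfl⟩) (by simp)⟩
    · exact ⟨2, hE _ _ (Or.inr ⟨rfl, rfl⟩) (by simp)⟩
  have hdist : ∀ v, |f (Sum.inl 3) - f v| ≤ 2 * b := by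
    rintro (i | v | i | i)
    · have := hS i; rw [abs_le] at *; omega
    · obtain ⟨j, hj⟩ := hX v
      have := hS j; rw [abs_le] at *; omega
    · have := hS 1
      have := hY i; rw [abs_le] at *; omega
    · have := hW i; rw [abs_le] at *; omega
  have hp : f (Sum.inl 3) = 2 * b := by
    obtain ⟨v0, -, h0⟩ := hbij.surjOn (show (0 : ℤ) ∈ Set.Icc (0 : ℤ) (4 * b) by
      constructor <;> omega)
    obtain ⟨v1, -, h1⟩ := hbij.surjOn (show (4 * b : ℤ) ∈ Set.Icc (0 : ℤ) (4 * b) by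
      constructor <;> omega)
    have a0 := hdist v0
    have a1 := hdist v1
    rw [abs_le] at a0 a1
    omega
  rw [hp] at hS hW
  let g : Fin 4 ⊕ Fin (2 * b - 3) → ℤ :=
    Sum.elim (fun i => f (Sum.inl i)) (fun i => f (Sum.inr (Sum.inr (Sum.inr i))))
  have hg : Function.Injective g := by
    rintro (i | i) (j | j) h <;> simpa using hinj h
  have hwin : Finset.univ.image g = Finset.Icc (b : ℤ) (3 * b) := by
    apply Finset.eq_of_subset_of_card_le
    · intro k hk
      obtain ⟨i, -, rfl⟩ := Finset.mem_image.1 hk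
      rw [Finset.mem_Icc]
      rcases i with i | i
      · have := hS i; rw [abs_le] at this; simp only [g, Sum.elim_inl]; omega
      · have := hW i; rw [abs_le] at this; simp only [g, Sum.elim_inr]; omega
    · rw [Finset.card_image_of_injective _ hg, Int.card_Icc, Finset.card_univ]
      simp only [Fintype.card_sum, Fintype.card_fin]
      omega
  have hout : ∀ v, (∀ i, v ≠ Sum.inl i) → (∀ i, v ≠ Sum.inr (Sum.inr (Sum.inr i))) →
      f v < b ∨ 3 * b < f v := by
    intro v h1 h2
    by_contra hc
    have : f v ∈ Finset.univ.image g := by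
      rw [hwin, Finset.mem_Icc]; omega
    obtain ⟨i | i, -, hi⟩ := Finset.mem_image.1 this
    · exact h1 i (hinj hi).symm
    · exact h2 i (hinj hi).symm
  have hYo : ∀ i, _ := fun i => hout (Sum.inr (Sum.inr (Sum.inl i))) (by simp) (by simp)
  have hXo : ∀ v, _ := fun v => hout (Sum.inr (Sum.inl v)) (by simp) (by simp)
  have hYinj : Function.Injective (fun i : Fin b => f (Sum.inr (Sum.inr (Sum.inl i)))) := by
    intro i j h
    simpa using hinj h
  have hside : ∀ c : ℤ, (∀ i : Fin b, f (Sum.inr (Sum.inr (Sum.inl i))) ∈ Finset.Ico c (c + b)) →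
      ∀ v, f (Sum.inr (Sum.inl v)) ∉ Finset.Ico c (c + b) := by
    intro c hc v hv
    have : Finset.univ.image (fun i : Fin b => f (Sum.inr (Sum.inr (Sum.inl i))))
        = Finset.Ico c (c + b) := by
      apply Finset.eq_of_subset_of_card_le
      · intro k hk
        obtain ⟨i, -, rfl⟩ := Finset.mem_image.1 hk
        exact hc i
      · rw [Finset.card_image_of_injective _ hYinj, Int.card_Ico, Finset.card_univ]
        simp
    rw [← this] at hv
    obtain ⟨i, -, hi⟩ := Finset.mem_image.1 hv
    simpa using hinj hi
  have hne : f (Sum.inl 1) ≠ 2 * b := by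
    rw [← hp]
    intro h
    simpa using hinj h
  rcases lt_or_gt_of_ne hne with hlt | hgt
  · right
    intro v
    have := hside 0 (fun i => by
      have h1 := hYo i
      have h2 := hY i
      have h3 := hmem (Sum.inr (Sum.inr (Sum.inl i)))
      rw [abs_le] at h2
      rw [Finset.mem_Ico]; omega) v
    have h1 := hXo v
    have h3 := hmem (Sum.inr (Sum.inl v))
    rw [Finset.mem_Ico] at this
    omega
  · left
    intro v
    have := hside (3 * b + 1) (fun i => by
      have h1 := hYo i
      have h2 := hY i
      have h3 := hmem (Sum.inr (Sum.inr (Sum.inl i)))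
      rw [abs_le] at h2
      rw [Finset.mem_Ico]; omega) v
    have h1 := hXo v
    have h3 := hmem (Sum.inr (Sum.inl v))
    rw [Finset.mem_Ico] at this
    omega
end
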